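/- Let v₁, v₂ ∈ ℂ be algebraically independent over ℚ. Let L be a differential field extension of ℂ(t) with derivation D, K a differential subfield of L, n ≥ 2, and let (y₁,x₁), …, (yₙ,xₙ) ∈ L² be solutions of the system S_III'(v₁,v₂): t·y' = 2y²x − y² + v₁y + t and t·x' = −2yx² + 2yx − v₁x + (v₁+v₂)/2. If the 2n elements y₁, x₁, …, yₙ, xₙ are NOT algebraically independent over K, then there exist 1 ≤ i < j ≤ n such that the four elements yᵢ, xᵢ, yⱼ, xⱼ are not algebraically independent over K. (Geometric triviality of generic S_III'; Proposition 3.9.) -/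

import Mathlib

open Polynomial

theorem Int.exists_max_of_bdd {P : ℤ → Prop} {B z : ℤ} (hB : ∀ i, P i → i ≤ B) (hz : P z) :
    ∃ m, P m ∧ ∀ i, P i → i ≤ m := by
  obtain ⟨m, hm, h⟩ := Int.exists_greatest_of_bdd (P := P) ⟨B, hB⟩ ⟨z, hz⟩
  exact ⟨m, hm, h⟩

theorem Int.exists_min_of_bdd {P : ℤ → Prop} {B z : ℤ} (hB : ∀ i, P i → B ≤ i) (hz : P z) :
    ∃ m, P m ∧ ∀ i, P i → m ≤ i := by
  obtain ⟨m, hm, h⟩ := Int.exists_least_of_bdd (P := P) ⟨B, hB⟩ ⟨z, hz⟩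
  exact ⟨m, hm, h⟩

/-- A finitely supported solution of the coefficient recurrence of the third Painlevé vector field
is supported at the origin. -/
theorem coeff_eq_zero_of_recurrence {K U : Type*} [Field K] [CharZero K] [AddCommGroup U]
    [Module K U] (N : U →+ U) (t a c α β ε : K) (ht : t ≠ 0)
    (hN : ∀ u, N (t • u) = t • u + t • N u)
    (hlin : ∀ s q r : ℤ, (a - 1) * s = c * q + (a - c) * r → s = 0 ∧ q = 0 ∧ r = 0)
    (f : ℤ → ℤ → U) (hneg : ∀ i j, i < 0 ∨ j < 0 → f i j = 0)
    (B : ℤ) (hB : ∀ i j, B < i ∨ B < j → f i j = 0)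
    (hR : ∀ i j : ℤ, (α = 0 → ¬ (i = 0 ∧ j = 0)) →
      (2 * ((i : K) - j) - α) • f (i - 1) (j - 1) + (2 * (j : K) - i + 1 - β) • f (i - 1) j
        + N (f i j) + (a * ((i : K) - j)) • f i j + (t * ((i : K) + 1)) • f (i + 1) j
        + (c * ((j : K) + 1)) • f i (j + 1) - ε • f i (j - 1) = 0) :
    ∀ i j, ¬ (i = 0 ∧ j = 0) → f i j = 0 := by
  by_contra! hcon
  obtain ⟨i0, j0, h00, hf0⟩ := hcon
  have hi : ∀ i j, f i j ≠ 0 → 0 ≤ i ∧ 0 ≤ j ∧ i ≤ B ∧ j ≤ B := by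
    intro i j h
    refine ⟨?_, ?_, ?_, ?_⟩ <;> by_contra! hh
    · exact h (hneg _ _ (Or.inl hh))
    · exact h (hneg _ _ (Or.inr hh))
    · exact h (hB _ _ (Or.inl hh))
    · exact h (hB _ _ (Or.inr hh))
  obtain ⟨p, ⟨jp, hjp⟩, hp⟩ := Int.exists_max_of_bdd (P := fun i => ∃ j, f i j ≠ 0) (B := B)
    (z := i0) (fun i ⟨j, h⟩ => (hi i j h).2.2.1) ⟨j0, hf0⟩
  obtain ⟨n, hn, hnmax⟩ := Int.exists_max_of_bdd (P := fun j => f p j ≠ 0) (B := B)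
    (z := jp) (fun j h => (hi p j h).2.2.2) hjp
  obtain ⟨q, hq, hqmin⟩ := Int.exists_min_of_bdd (P := fun j => f p j ≠ 0) (B := 0)
    (z := jp) (fun j h => (hi p j h).2.1) hjp
  obtain ⟨m, ⟨im, jm, hm, hfm⟩, hmmax⟩ := Int.exists_max_of_bdd
    (P := fun m => ∃ i j, 2 * j - i = m ∧ f i j ≠ 0) (B := 2 * B)
    (z := 2 * n - p) (by rintro _ ⟨i, j, rfl, h⟩; have := hi i j h; omega) ⟨p, n, rfl, hn⟩
  obtain ⟨i₁, ⟨j₁, hl₁, hf₁⟩, hi₁⟩ := Int.exists_max_of_bdd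
    (P := fun i => ∃ j, 2 * j - i = m ∧ f i j ≠ 0) (B := B) (z := im)
    (fun i ⟨j, _, h⟩ => (hi i j h).2.2.1) ⟨jm, hm, hfm⟩
  obtain ⟨i₂, ⟨j₂, hl₂, hf₂⟩, hi₂⟩ := Int.exists_min_of_bdd
    (P := fun i => ∃ j, 2 * j - i = m ∧ f i j ≠ 0) (B := 0) (z := im)
    (fun i ⟨j, _, h⟩ => (hi i j h).1) ⟨jm, hm, hfm⟩
  have zp : ∀ i j, p < i → f i j = 0 := by
    intro i j h; by_contra hh; have := hp i ⟨j, hh⟩; omega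
  have zn : ∀ j, n < j → f p j = 0 := by
    intro j h; by_contra hh; have := hnmax j hh; omega
  have zq : ∀ j, j < q → f p j = 0 := by
    intro j h; by_contra hh; have := hqmin j hh; omega
  have zm : ∀ i j, m < 2 * j - i → f i j = 0 := by
    intro i j h; by_contra hh; have := hmmax _ ⟨i, j, rfl, hh⟩; omega
  have z1 : ∀ i j, 2 * j - i = m → i₁ < i → f i j = 0 := by
    intro i j hl h; by_contra hh; have := hi₁ _ ⟨j, hl, hh⟩; omega
  have z2 : ∀ i j, 2 * j - i = m → i < i₂ → f i j = 0 := by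
    intro i j hl h; by_contra hh; have := hi₂ _ ⟨j, hl, hh⟩; omega
  have b0 := hi _ _ hn
  have bq := hi _ _ hq
  have b1 := hi _ _ hf₁
  have b2 := hi _ _ hf₂
  have hqn : q ≤ n := hnmax _ hq
  -- the coefficient of `x` in the cofactor vanishes
  have hε : ε = 0 := by
    have h := hR im (jm + 1) (by have := hi _ _ hfm; omega)
    rw [zm (im - 1) (jm + 1 - 1) (by omega), zm (im - 1) (jm + 1) (by omega),
      zm im (jm + 1) (by omega), zm (im + 1) (jm + 1) (by omega),
      zm im (jm + 1 + 1) (by omega)] at h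
    simpa [hfm] using h
  subst hε
  simp only [zero_smul, sub_zero] at hR
  -- top row
  have hrow : ∀ j : ℤ, (2 * ((p : K) + 1 - j) - α) • f p (j - 1) + (2 * (j : K) - p - β) • f p j
      = 0 := by
    intro j
    have h := hR (p + 1) j (by omega)
    rw [zp (p + 1) j (by omega), zp (p + 1 + 1) j (by omega),
      zp (p + 1) (j + 1) (by omega)] at h
    push_cast at h
    simp only [map_zero, smul_zero, add_zero, add_sub_cancel_right] at h
    rw [← h]; congr 2; ring
  have hβ : β = 2 * q - p := by
    have h := hrow q
    rw [zq (q - 1) (by omega)] at h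
    simp only [smul_zero, zero_add, smul_eq_zero, hq, or_false] at h
    linear_combination -h
  have hα : α = 2 * ((p : K) - n) := by
    have h := hrow (n + 1)
    rw [zn (n + 1) (by omega), add_sub_cancel_right] at h
    simp only [smul_zero, add_zero, smul_eq_zero, hn, or_false] at h
    push_cast at h
    linear_combination -h
  have hα0 : α = 0 → p = n ∧ 0 < p := by
    intro h0
    have h1 : p = n := by
      have h2 : (p : K) = n := by
        have h3 : (2 : K) * ((p : K) - n) = 0 := by rw [← hα, h0]
        have h4 := (mul_eq_zero.mp h3).resolve_left two_ne_zero
        linear_combination h4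
      exact_mod_cast h2
    refine ⟨h1, ?_⟩
    by_contra hp0
    have hi0 := hi _ _ hf0
    have h5 := hp i0 ⟨j0, hf0⟩
    have h6 : i0 = p := by omega
    rw [h6] at hf0
    have h7 := hnmax j0 hf0
    omega
  -- relation along the top row
  have hF : ∀ j : ℤ, ((n : K) - j) • f p j = -(((j : K) + 1 - q) • f p (j + 1)) := by
    intro j
    have h := hrow (j + 1)
    rw [add_sub_cancel_right, hα, hβ] at h
    push_cast at h
    have h2 : (2 : K) • (((n : K) - j) • f p j + ((j : K) + 1 - q) • f p (j + 1)) = 0 := by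
      rw [← h, smul_add, smul_smul, smul_smul]; congr 2 <;> ring
    rw [smul_eq_zero] at h2
    exact eq_neg_of_add_eq_zero_left (h2.resolve_left two_ne_zero)
  -- the extremal line
  have hm1 : i₁ = p ∧ m = 2 * n - p := by
    have h := hR (i₁ + 1) (j₁ + 1) (by omega)
    rw [add_sub_cancel_right, add_sub_cancel_right, zm (i₁) (j₁ + 1) (by omega),
      zm (i₁ + 1) (j₁ + 1) (by omega), z1 (i₁ + 1 + 1) (j₁ + 1) (by omega) (by omega),
      zm (i₁ + 1) (j₁ + 1 + 1) (by omega)] at h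
    simp only [map_zero, smul_zero, add_zero, smul_eq_zero, hf₁, or_false] at h
    rw [hα] at h
    push_cast at h
    have h3 : ((i₁ - j₁ : ℤ) : K) = ((p - n : ℤ) : K) := by
      push_cast
      have h4 : (2 : K) * (((i₁ : K) - j₁) - (p - n)) = 0 := by linear_combination h
      have := (mul_eq_zero.mp h4).resolve_left two_ne_zero
      linear_combination this
    have h5 : i₁ - j₁ = p - n := by exact_mod_cast h3
    have h6 := hp i₁ ⟨j₁, hf₁⟩
    have h7 := hmmax (2 * n - p) ⟨p, n, rfl, hn⟩
    omega
  obtain ⟨-, hmn⟩ := hm1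
  have hR0 : α = 0 → 0 < m := by
    intro h; have := hα0 h; omega
  have hi20 : i₂ = 0 := by
    have h := hR (i₂ - 1) j₂ (by intro h; have := hR0 h; omega)
    rw [z2 (i₂ - 1 - 1) (j₂ - 1) (by omega) (by omega), zm (i₂ - 1 - 1) j₂ (by omega),
      zm (i₂ - 1) j₂ (by omega), zm (i₂ - 1) (j₂ + 1) (by omega), sub_add_cancel] at h
    simp only [map_zero, smul_zero, add_zero, zero_add, smul_eq_zero, hf₂, or_false,
      mul_eq_zero, ht, false_or] at h
    push_cast at h
    have : (i₂ : K) = 0 := by linear_combination h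
    exact_mod_cast this
  obtain ⟨s, hs⟩ : ∃ s, p = 2 * s := ⟨n - j₂, by omega⟩
  obtain ⟨k0, hk0⟩ : ∃ k0, k0 = n - s := ⟨_, rfl⟩
  have hmk : m = 2 * k0 := by omega
  have hlast : f (p - 1) n = 0 := zm _ _ (by omega)
  have hNn : N (f p n) = -((a * ((p : K) - n)) • f p n) := by
    have h := hR p n (by intro h; have := hα0 h; omega)
    rw [hlast, zp (p + 1) n (by omega), zn (n + 1) (by omega)] at h
    have h0 : 2 * ((p : K) - n) - α = 0 := by rw [hα]; ring
    rw [h0] at h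
    simp only [zero_smul, smul_zero, add_zero, zero_add] at h
    exact eq_neg_of_add_eq_zero_left h
  -- chain along the extremal line
  have hh : ∀ k : ℤ, ((s : K) - k) • f (2 * k) (k0 + k)
      = t • ((k : K) + 1) • f (2 * (k + 1)) (k0 + (k + 1)) := by
    intro k
    have h := hR (2 * k + 1) (k0 + (k + 1)) (by intro; omega)
    rw [show 2 * k + 1 - 1 = 2 * k by ring, show k0 + (k + 1) - 1 = k0 + k by ring,
      zm (2 * k) (k0 + (k + 1)) (by omega), zm (2 * k + 1) (k0 + (k + 1)) (by omega),
      zm (2 * k + 1) _ (by omega), show 2 * k + 1 + 1 = 2 * (k + 1) by ring] at h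
    simp only [map_zero, smul_zero, add_zero] at h
    have h2 : (2 : K) • (((s : K) - k) • f (2 * k) (k0 + k)
        - t • ((k : K) + 1) • f (2 * (k + 1)) (k0 + (k + 1))) = 0 := by
      rw [hα, hk0, hs] at h
      rw [hk0, smul_sub, smul_smul, smul_smul, smul_smul, ← neg_eq_zero, ← h]
      rw [neg_sub, sub_eq_neg_add, ← neg_smul]
      push_cast
      congr 2 <;> ring
    exact sub_eq_zero.mp ((smul_eq_zero.mp h2).resolve_left two_ne_zero)
  have hNint : ∀ (z : ℤ) (u : U), N ((z : K) • u) = (z : K) • N u := by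
    intro z u; rw [Int.cast_smul_eq_zsmul, Int.cast_smul_eq_zsmul, map_zsmul]
  have hNh : ∀ d : ℕ, N (f (2 * (s - d)) (k0 + (s - d)))
      = ((d : K) - a * ((p : K) - n)) • f (2 * (s - d)) (k0 + (s - d)) := by
    intro d
    induction d with
    | zero =>
      have e1 : 2 * (s - ((0 : ℕ) : ℤ)) = p := by push_cast; omega
      have e2 : k0 + (s - ((0 : ℕ) : ℤ)) = n := by push_cast; omega
      rw [e1, e2, hNn]; simp
    | succ d ih =>
      have h := hh (s - (d + 1 : ℕ))
      rw [show s - ((d + 1 : ℕ) : ℤ) + 1 = s - (d : ℤ) by push_cast; ring] at h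
      have e1 : ((s : K) - ((s - ((d + 1 : ℕ) : ℤ) : ℤ) : K)) = ((d + 1 : ℤ) : K) := by
        push_cast; ring
      have e2 : (((s - ((d + 1 : ℕ) : ℤ) : ℤ) : K) + 1) = ((s - d : ℤ) : K) := by
        push_cast; ring
      rw [e1, e2] at h
      have h2 := congrArg N h
      rw [hNint, hN, hNint, ih] at h2
      have h3 : ((d + 1 : ℤ) : K) •
          N (f (2 * (s - ((d + 1 : ℕ) : ℤ))) (k0 + (s - ((d + 1 : ℕ) : ℤ))))
          = ((d + 1 : ℤ) : K) • ((((d + 1 : ℕ) : K) - a * ((p : K) - n)) •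
            f (2 * (s - ((d + 1 : ℕ) : ℤ))) (k0 + (s - ((d + 1 : ℕ) : ℤ)))) := by
        rw [h2, smul_comm ((d + 1 : ℤ) : K) _ (f _ _), h]
        push_cast
        module
      have h4 : ((d + 1 : ℤ) : K) ≠ 0 := by exact_mod_cast Nat.succ_ne_zero d
      exact smul_right_injective U h4 h3
  have hs0 : 0 ≤ s := by omega
  have hNh' : ∀ k : ℤ, 0 ≤ k → k ≤ s → N (f (2 * k) (k0 + k))
      = ((s : K) - k - a * ((p : K) - n)) • f (2 * k) (k0 + k) := by
    intro k _ hks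
    have h := hNh (s - k).toNat
    have e : ((s - k).toNat : ℤ) = s - k := Int.toNat_of_nonneg (by omega)
    have e' : (((s - k).toNat : ℕ) : K) = (s : K) - k := by
      rw [← Int.cast_natCast, e]; push_cast; rfl
    rw [e, e', sub_sub_cancel] at h
    exact h
  have hg : ∀ k : ℕ, (k : ℤ) ≤ s → f (2 * (k : ℤ) - 1) (k0 + (k : ℤ) - 1)
      = ((a - 1) * (k : K)) • f (2 * (k : ℤ)) (k0 + k) := by
    intro k
    induction k with
    | zero => intro _; rw [hneg _ _ (Or.inl (by norm_num))]; simp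
    | succ k ih =>
      intro hk
      have ih' := ih (by omega)
      have h := hR (2 * k) (k0 + k) (by intro h; have := hR0 h; omega)
      rw [ih', zm (2 * (k : ℤ) - 1) (k0 + k) (by omega), hNh' k (by omega) (by omega),
        zm (2 * (k : ℤ)) (k0 + k + 1) (by omega), hα] at h
      have hhk := hh k
      have e1 : 2 * ((k + 1 : ℕ) : ℤ) - 1 = 2 * (k : ℤ) + 1 := by push_cast; ring
      have e2 : k0 + ((k + 1 : ℕ) : ℤ) - 1 = k0 + k := by push_cast; ring
      have e3 : ((k + 1 : ℕ) : ℤ) = (k : ℤ) + 1 := by push_cast; ring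
      rw [e1, e2, e3]
      have h4 : t * (2 * (k : K) + 1) ≠ 0 := by
        refine mul_ne_zero ht ?_
        exact_mod_cast Nat.succ_ne_zero (2 * k)
      refine smul_right_injective U h4 ?_
      have hps : (p : K) = 2 * s := by rw [hs]; push_cast; ring
      have hk0' : (k0 : K) = n - s := by rw [hk0]; push_cast; ring
      simp only [smul_zero, add_zero] at h
      push_cast at h hhk ⊢
      rw [hps, hk0'] at h
      have h5 : (t * (2 * (k : K) + 1)) • f (2 * (k : ℤ) + 1) (k0 + k)
          = ((2 * (k : K) + 1) * (a - 1)) • (((s : K) - k) • f (2 * k) (k0 + k)) := by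
        rw [← sub_eq_zero, ← h]
        module
      show _ • _ = _ • _
      rw [h5, hhk]
      module
  have hgs : f (p - 1) (n - 1) = ((a - 1) * (s : K)) • f p n := by
    have h := hg s.toNat (by omega)
    have e : (s.toNat : ℤ) = s := Int.toNat_of_nonneg hs0
    have e' : ((s.toNat : ℕ) : K) = (s : K) := by rw [← Int.cast_natCast, e]
    rw [e, e', show k0 + s = n by omega, ← hs] at h
    exact h
  -- second row
  have hNF : ∀ d : ℕ, q ≤ n - d →  N (f p (n - d)) = -((a * ((p : K) - n)) • f p (n - d)) := by
    intro d
    induction d with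
    | zero => intro _; simpa using hNn
    | succ d ih =>
      intro hd
      have ih' := ih (by push_cast at hd; omega)
      have h := hF (n - (d + 1 : ℕ))
      rw [show n - ((d + 1 : ℕ) : ℤ) + 1 = n - (d : ℤ) by push_cast; ring] at h
      have e1 : ((n : K) - ((n - ((d + 1 : ℕ) : ℤ) : ℤ) : K)) = ((d + 1 : ℤ) : K) := by
        push_cast; ring
      have e2 : (((n - ((d + 1 : ℕ) : ℤ) : ℤ) : K) + 1 - q) = ((n - d - q : ℤ) : K) := by
        push_cast; ring
      rw [e1, e2] at h
      have h2 := congrArg N h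
      rw [hNint, map_neg, hNint, ih'] at h2
      have h4 : ((d + 1 : ℤ) : K) ≠ 0 := by exact_mod_cast Nat.succ_ne_zero d
      refine smul_right_injective U h4 ?_
      show _ • _ = _ • _
      rw [h2, smul_neg, smul_neg, smul_comm ((d + 1 : ℤ) : K) _ (f _ _), h]
      module
  have hNF' : ∀ j : ℤ, N (f p j) = -((a * ((p : K) - n)) • f p j) := by
    intro j
    by_cases h1 : f p j = 0
    · simp [h1]
    have h := hNF (n - j).toNat
    have e : ((n - j).toNat : ℤ) = n - j := Int.toNat_of_nonneg (by have := hnmax j h1; omega)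
    rw [e, sub_sub_cancel] at h
    exact h (hqmin j h1)
  have hG : ∀ j : ℤ, (2 * ((n : K) - j)) • f (p - 1) (j - 1) + (2 * ((j : K) - q) + 1) • f (p - 1) j
      + (a * ((n : K) - j)) • f p j + (c * ((j : K) + 1)) • f p (j + 1) = 0 := by
    intro j
    have h := hR p j (by intro h; have := hα0 h; omega)
    rw [hNF', zp (p + 1) j (by omega), hα, hβ] at h
    rw [← h]
    module
  have hΔ : ∀ j : ℤ, f (p - 1) j = (c * q + (a - c) * ((j : K) + 1 - q)) • f p (j + 1) := by
    by_contra! hcon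
    obtain ⟨j3, hj3⟩ := hcon
    obtain ⟨j4, hj4, hj4min⟩ := Int.exists_min_of_bdd
      (P := fun j => f (p - 1) j ≠ (c * q + (a - c) * ((j : K) + 1 - q)) • f p (j + 1))
      (B := -1) (z := j3) (by
        intro j hj
        by_contra! hj1
        refine hj ?_
        rw [hneg _ _ (Or.inr (by omega)), hneg _ _ (Or.inr (by omega)), smul_zero]) hj3
    have hprev : f (p - 1) (j4 - 1) = (c * q + (a - c) * ((j4 : K) - q)) • f p j4 := by
      by_contra hne
      have := hj4min (j4 - 1) (by
        push_cast
        rw [sub_add_cancel, sub_add_cancel]; exact hne)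
      omega
    have h := hG j4
    have hFj := hF j4
    rw [hprev] at h
    have h5 : (2 * ((j4 : K) - q) + 1) ≠ 0 := by
      have : ((2 * (j4 - q) + 1 : ℤ) : K) ≠ 0 := by
        rw [Int.cast_ne_zero]; omega
      push_cast at this
      exact this
    refine hj4 (smul_right_injective U h5 ?_)
    show _ • _ = _ • _
    have h6 : (2 * ((j4 : K) - q) + 1) • f (p - 1) j4
        = (-(2 * (c * q + (a - c) * ((j4 : K) - q)) + a)) • (((n : K) - j4) • f p j4)
          - (c * ((j4 : K) + 1)) • f p (j4 + 1) := by
      rw [← sub_eq_zero, ← h]; module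
    rw [h6, hFj]
    module
  have hfin := hΔ (n - 1)
  rw [hgs, sub_add_cancel] at hfin
  have hfin2 := smul_left_injective K hn hfin
  push_cast at hfin2
  obtain ⟨hs', hq', hr'⟩ := hlin s q (n - q) (by push_cast; rw [hfin2]; ring)
  have hi0 := hi _ _ hf0
  have h5 := hp i0 ⟨j0, hf0⟩
  have h6 : i0 = p := by omega
  rw [h6] at hf0
  have h7 := hnmax j0 hf0
  omega

section Bivariate

/-- Derivations of a commutative ring into itself. -/
abbrev Der (R : Type*) [CommRing R] := Derivation ℤ R R

/-- The derivation of `A[X]` acting by `d` on each coefficient. -/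
noncomputable def Der.coeffwise {A : Type*} [CommRing A] (d : Der A) : Der A[X] :=
  Derivation.mk'
    (AddMonoidHom.toIntLinearMap
      { toFun := fun p => PolynomialModule.equivPolynomialSelf (d.mapCoeffs p)
        map_zero' := by simp
        map_add' := by simp })
    (by
      intro p q
      change PolynomialModule.equivPolynomialSelf (d.mapCoeffs (p * q)) =
        p • PolynomialModule.equivPolynomialSelf (d.mapCoeffs q) + q • _
      rw [Derivation.leibniz, map_add, map_smul, map_smul]
      rfl)

@[simp] theorem Der.coeff_coeffwise {A : Type*} [CommRing A] (d : Der A)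
    (p : A[X]) (n : ℕ) : (d.coeffwise p).coeff n = d (p.coeff n) := rfl

@[simp] theorem Der.coeffwise_C {A : Type*} [CommRing A] (d : Der A)
    (r : A) : d.coeffwise (C r) = C (d r) := by
  ext n; simp [coeff_C, apply_ite d]

@[simp] theorem Der.coeffwise_X {A : Type*} [CommRing A] (d : Der A) :
    d.coeffwise (X : A[X]) = 0 := by
  ext n; simp [coeff_X, apply_ite d]

variable {K : Type*} [Field K]

/-- The formal derivative as a derivation over `ℤ`. -/
noncomputable def formalDer (A : Type*) [CommRing A] : Der A[X] :=
  Derivation.mk' (AddMonoidHom.toIntLinearMap (derivative (R := A)).toAddMonoidHom)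
    (by intro p q; simp [derivative_mul]; ring)

@[simp] theorem formalDer_apply {A : Type*} [CommRing A] (p : A[X]) :
    formalDer A p = derivative p := rfl

/-- The partial derivative of `K[X][Y]` with respect to the inner variable. -/
noncomputable def innerDer (A : Type*) [CommRing A] : Der A[X][X] :=
  (formalDer A).coeffwise

/-- The partial derivative of `K[X][Y]` with respect to the outer variable. -/
noncomputable def outerDer (A : Type*) [CommRing A] : Der A[X][X] :=
  formalDer A[X]

/-- The value `t y'` for the third Painlevé system. -/
noncomputable def pvA (t a : K) : K[X][X] :=
  2 * X ^ 2 * C X - X ^ 2 + C (C a) * X + C (C t)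

/-- The value `t x'` for the third Painlevé system. -/
noncomputable def pvB (a c : K) : K[X][X] :=
  2 * X * C X - 2 * X * C X ^ 2 - C (C a) * C X + C (C c)

/-- The derivation of `K[X][Y]` induced by the third Painlevé system. -/
noncomputable def pvDer (δ : Der K) (t a c : K) : Der K[X][X] :=
  δ.coeffwise.coeffwise + pvA t a • outerDer K + pvB a c • innerDer K

theorem pvDer_apply (δ : Der K) (t a c : K) (p : K[X][X]) :
    pvDer δ t a c p = δ.coeffwise.coeffwise p + pvA t a * outerDer K p + pvB a c * innerDer K p :=
  rfl

/-- The coefficient of `Y ^ i X ^ j`, extended by zero to integer exponents. -/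
noncomputable def bicoeff (p : K[X][X]) (i j : ℤ) : K :=
  if 0 ≤ i ∧ 0 ≤ j then (p.coeff i.toNat).coeff j.toNat else 0

theorem bicoeff_natCast (p : K[X][X]) (i j : ℕ) : bicoeff p i j = (p.coeff i).coeff j := by
  simp [bicoeff]

theorem bicoeff_neg (p : K[X][X]) (i j : ℤ) (h : i < 0 ∨ j < 0) : bicoeff p i j = 0 := by
  rw [bicoeff, if_neg (by omega)]

theorem bicoeff_add (p q : K[X][X]) (i j : ℤ) :
    bicoeff (p + q) i j = bicoeff p i j + bicoeff q i j := by
  unfold bicoeff; split_ifs <;> simp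

theorem bicoeff_neg' (p : K[X][X]) (i j : ℤ) :
    bicoeff (-p) i j = - bicoeff p i j := by
  unfold bicoeff; split_ifs <;> simp

theorem bicoeff_sub (p q : K[X][X]) (i j : ℤ) :
    bicoeff (p - q) i j = bicoeff p i j - bicoeff q i j := by
  unfold bicoeff; split_ifs <;> simp

theorem bicoeff_sum {ι : Type*} (s : Finset ι) (p : ι → K[X][X]) (i j : ℤ) :
    bicoeff (∑ k ∈ s, p k) i j = ∑ k ∈ s, bicoeff (p k) i j := by
  classical
  induction s using Finset.induction_on with
  | empty => simp [bicoeff]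
  | insert a s ha ih => rw [Finset.sum_insert ha, bicoeff_add, ih, Finset.sum_insert ha]

theorem bicoeff_CC_mul (r : K) (p : K[X][X]) (i j : ℤ) :
    bicoeff (C (C r) * p) i j = r * bicoeff p i j := by
  unfold bicoeff; split_ifs <;> simp

theorem bicoeff_two_mul (p : K[X][X]) (i j : ℤ) :
    bicoeff (2 * p) i j = 2 * bicoeff p i j := by
  rw [two_mul, bicoeff_add, two_mul]

theorem bicoeff_X_mul (p : K[X][X]) (i j : ℤ) :
    bicoeff (X * p) i j = bicoeff p (i - 1) j := by
  rcases lt_or_ge j 0 with hj | hj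
  · rw [bicoeff_neg _ _ _ (Or.inr hj), bicoeff_neg _ _ _ (Or.inr hj)]
  rcases lt_trichotomy i 0 with hi | hi | hi
  · rw [bicoeff_neg _ _ _ (Or.inl hi), bicoeff_neg _ _ _ (Or.inl (by omega))]
  · subst hi; simp [bicoeff]
  · obtain ⟨n, rfl⟩ : ∃ n : ℕ, i = (n : ℤ) + 1 := ⟨(i - 1).toNat, by omega⟩
    obtain ⟨m, rfl⟩ : ∃ m : ℕ, j = (m : ℤ) := ⟨j.toNat, by omega⟩
    rw [add_sub_cancel_right, bicoeff_natCast]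
    have := bicoeff_natCast (X * p) (n + 1) m
    push_cast at this
    rw [this, coeff_X_mul]

theorem bicoeff_CX_mul (p : K[X][X]) (i j : ℤ) :
    bicoeff (C X * p) i j = bicoeff p i (j - 1) := by
  rcases lt_or_ge i 0 with hi | hi
  · rw [bicoeff_neg _ _ _ (Or.inl hi), bicoeff_neg _ _ _ (Or.inl hi)]
  rcases lt_trichotomy j 0 with hj | hj | hj
  · rw [bicoeff_neg _ _ _ (Or.inr hj), bicoeff_neg _ _ _ (Or.inr (by omega))]
  · subst hj; simp [bicoeff]
  · obtain ⟨n, rfl⟩ : ∃ n : ℕ, i = (n : ℤ) := ⟨i.toNat, by omega⟩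
    obtain ⟨m, rfl⟩ : ∃ m : ℕ, j = (m : ℤ) + 1 := ⟨(j - 1).toNat, by omega⟩
    rw [add_sub_cancel_right, bicoeff_natCast]
    have := bicoeff_natCast (C X * p) n (m + 1)
    push_cast at this
    rw [this, coeff_C_mul, coeff_X_mul]

theorem bicoeff_outerDer (p : K[X][X]) (i j : ℤ) :
    bicoeff (outerDer K p) i j = ((i : K) + 1) * bicoeff p (i + 1) j := by
  rcases lt_or_ge j 0 with hj | hj
  · rw [bicoeff_neg _ _ _ (Or.inr hj), bicoeff_neg _ _ _ (Or.inr hj), mul_zero]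
  rcases lt_trichotomy i (-1) with hi | hi | hi
  · rw [bicoeff_neg _ _ _ (Or.inl (by omega)), bicoeff_neg _ _ _ (Or.inl (by omega)), mul_zero]
  · subst hi; rw [bicoeff_neg _ _ _ (Or.inl (by omega))]; simp
  · obtain ⟨n, rfl⟩ : ∃ n : ℕ, i = (n : ℤ) := ⟨i.toNat, by omega⟩
    obtain ⟨m, rfl⟩ : ∃ m : ℕ, j = (m : ℤ) := ⟨j.toNat, by omega⟩
    rw [bicoeff_natCast]
    have := bicoeff_natCast p (n + 1) m
    push_cast at this
    rw [this, outerDer, formalDer_apply, coeff_derivative]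
    have : ((n : K[X]) + 1) = C ((n : K) + 1) := by simp
    rw [this, coeff_mul_C]; push_cast; ring

theorem bicoeff_innerDer (p : K[X][X]) (i j : ℤ) :
    bicoeff (innerDer K p) i j = ((j : K) + 1) * bicoeff p i (j + 1) := by
  rcases lt_or_ge i 0 with hi | hi
  · rw [bicoeff_neg _ _ _ (Or.inl hi), bicoeff_neg _ _ _ (Or.inl hi), mul_zero]
  rcases lt_trichotomy j (-1) with hj | hj | hj
  · rw [bicoeff_neg _ _ _ (Or.inr (by omega)), bicoeff_neg _ _ _ (Or.inr (by omega)), mul_zero]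
  · subst hj; rw [bicoeff_neg _ _ _ (Or.inr (by omega))]; simp
  · obtain ⟨n, rfl⟩ : ∃ n : ℕ, i = (n : ℤ) := ⟨i.toNat, by omega⟩
    obtain ⟨m, rfl⟩ : ∃ m : ℕ, j = (m : ℤ) := ⟨j.toNat, by omega⟩
    rw [bicoeff_natCast]
    have := bicoeff_natCast p n (m + 1)
    push_cast at this
    rw [this, innerDer, Der.coeff_coeffwise, formalDer_apply, coeff_derivative]
    push_cast; ring

theorem bicoeff_coeffwise (δ : Der K) (p : K[X][X]) (i j : ℤ) :
    bicoeff (δ.coeffwise.coeffwise p) i j = δ (bicoeff p i j) := by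
  unfold bicoeff; split_ifs <;> simp

theorem exists_bound_bicoeff (p : K[X][X]) :
    ∃ B : ℤ, ∀ i j, B < i ∨ B < j → bicoeff p i j = 0 := by
  classical
  refine ⟨((max p.natDegree (p.support.sup fun n => (p.coeff n).natDegree) : ℕ) : ℤ),
    fun i j h => ?_⟩
  unfold bicoeff
  split_ifs with h0
  · obtain ⟨n, rfl⟩ : ∃ n : ℕ, i = (n : ℤ) := ⟨i.toNat, by omega⟩
    obtain ⟨m, rfl⟩ : ∃ m : ℕ, j = (m : ℤ) := ⟨j.toNat, by omega⟩
    simp only [Int.toNat_natCast]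
    by_cases hn : n ∈ p.support
    · have h1 := le_natDegree_of_mem_supp _ hn
      have h2 := Finset.le_sup (f := fun n => (p.coeff n).natDegree) hn
      apply coeff_eq_zero_of_natDegree_lt
      push_cast at h
      omega
    · rw [notMem_support_iff.1 hn, coeff_zero]
  · rfl

theorem eq_CC_of_bicoeff (p : K[X][X]) (h : ∀ i j, ¬ (i = 0 ∧ j = 0) → bicoeff p i j = 0) :
    ∃ r, p = C (C r) := by
  refine ⟨(p.coeff 0).coeff 0, ?_⟩
  ext n m
  rw [coeff_C]
  by_cases hn : n = 0
  · subst hn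
    rw [if_pos rfl, coeff_C]
    split_ifs with hm
    · rw [hm]
    · rw [← bicoeff_natCast]; exact h _ _ (by omega)
  · rw [if_neg hn, ← bicoeff_natCast, coeff_zero]; exact h _ _ (by omega)

theorem bicoeff_CC (r : K) (i j : ℤ) (h : ¬ (i = 0 ∧ j = 0)) : bicoeff (C (C r)) i j = 0 := by
  unfold bicoeff
  split_ifs with h0
  · obtain ⟨n, rfl⟩ : ∃ n : ℕ, i = (n : ℤ) := ⟨i.toNat, by omega⟩
    obtain ⟨m, rfl⟩ : ∃ m : ℕ, j = (m : ℤ) := ⟨j.toNat, by omega⟩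
    simp only [Int.toNat_natCast]
    rw [coeff_C]
    split_ifs with h1
    · rw [coeff_C, if_neg]; omega
    · simp
  · rfl

theorem bicoeff_pvDer (δ : Der K) (t a c : K) (p : K[X][X]) (i j : ℤ) :
    bicoeff (pvDer δ t a c p) i j =
      (2 * ((i : K) - j)) * bicoeff p (i - 1) (j - 1) +
      (2 * (j : K) - i + 1) * bicoeff p (i - 1) j + δ (bicoeff p i j) +
      (a * ((i : K) - j)) * bicoeff p i j + (t * ((i : K) + 1)) * bicoeff p (i + 1) j +
      (c * ((j : K) + 1)) * bicoeff p i (j + 1) := by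
  have h : pvDer δ t a c p = δ.coeffwise.coeffwise p + (2 * (X * (X * (C X * outerDer K p)))
      - X * (X * outerDer K p) + C (C a) * (X * outerDer K p) + C (C t) * outerDer K p)
      + (-(2 * (X * (C X * (C X * innerDer K p)))) + 2 * (X * (C X * innerDer K p))
        - C (C a) * (C X * innerDer K p) + C (C c) * innerDer K p) := by
    rw [pvDer_apply, pvA, pvB]; ring
  rw [h]
  simp only [bicoeff_add, bicoeff_sub, bicoeff_neg', bicoeff_two_mul, bicoeff_CC_mul,
    bicoeff_X_mul, bicoeff_CX_mul, bicoeff_outerDer, bicoeff_innerDer, bicoeff_coeffwise]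
  have e1 : i - 1 - 1 + 1 = i - 1 := by ring
  have e2 : i - 1 + 1 = i := by ring
  have e3 : j - 1 - 1 + 1 = j - 1 := by ring
  have e4 : j - 1 + 1 = j := by ring
  rw [e1, e2, e3, e4]
  push_cast
  ring

/-- Polynomial solutions of a twisted linear system for the Painlevé derivation are constant. -/
theorem exists_CC_of_pvDer_eq [CharZero K] {ι : Type*} [Fintype ι]
    (δ : Der K) (t a c : K)
    (ht : t ≠ 0) (hδt : δ t = t)
    (hlin : ∀ s q r : ℤ, (a - 1) * s = c * q + (a - c) * r → s = 0 ∧ q = 0 ∧ r = 0)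
    (p : ι → K[X][X]) (α β ε : K) (M : ι → ι → K) (κ : ι → K) (hκ : α ≠ 0 → κ = 0)
    (h : ∀ j, pvDer δ t a c (p j) =
      (C (C α) * (X * C X) + C (C β) * X + C (C ε) * C X) * p j
        + ∑ i, C (C (M i j)) * p i + C (C (κ j))) :
    ∀ j, ∃ r, p j = C (C r) := by
  classical
  let N : (ι → K) →+ (ι → K) :=
    { toFun := fun u k => δ (u k) - ∑ i, M i k * u i
      map_zero' := by ext; simp
      map_add' := by intro u v; ext; simp [mul_add, Finset.sum_add_distrib]; ring }
  choose B hB using fun k => exists_bound_bicoeff (p k)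
  obtain ⟨b, hb⟩ : ∃ b : ℤ, ∀ k, B k ≤ b := by
    obtain ⟨b, hb⟩ := (Set.finite_range B).bddAbove
    exact ⟨b, fun k => hb ⟨k, rfl⟩⟩
  have key := coeff_eq_zero_of_recurrence N t a c α β ε ht
    (by
      intro u; ext k
      simp only [N, AddMonoidHom.coe_mk, ZeroHom.coe_mk, Pi.add_apply, Pi.smul_apply, smul_eq_mul,
        Derivation.leibniz, hδt]
      rw [mul_sub, Finset.mul_sum]
      have : ∀ i, M i k * (t * u i) = t * (M i k * u i) := fun i => by ring
      simp only [this]; ring)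
    hlin (fun i j k => bicoeff (p k) i j)
    (fun i j hij => by ext k; exact bicoeff_neg _ _ _ hij)
    b (fun i j hij => by
      ext k; exact hB k i j (hij.imp (lt_of_le_of_lt (hb k)) (lt_of_le_of_lt (hb k))))
    (by
      intro i j hij
      ext k
      have h1 := congrArg (fun q => bicoeff q i j) (h k)
      rw [bicoeff_pvDer, show (C (C α) * (X * C X) + C (C β) * X + C (C ε) * C X) * p k
        = C (C α) * (X * (C X * p k)) + C (C β) * (X * p k) + C (C ε) * (C X * p k) by ring] at h1
      simp only [bicoeff_add, bicoeff_sum, bicoeff_CC_mul, bicoeff_X_mul, bicoeff_CX_mul] at h1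
      have h2 : bicoeff (C (C (κ k))) i j = 0 := by
        by_cases hα : α = 0
        · exact bicoeff_CC _ _ _ (hij hα)
        · rw [hκ hα]; simp [bicoeff]
      rw [h2] at h1
      simp only [N, AddMonoidHom.coe_mk, ZeroHom.coe_mk, Pi.add_apply, Pi.sub_apply, Pi.smul_apply,
        smul_eq_mul, Pi.zero_apply]
      linear_combination h1)
  exact fun k => eq_CC_of_bicoeff _ fun i j hij => congrFun (key i j hij) k

end Bivariate

section Darboux
variable {K : Type*} [Field K]

theorem bicoeff_swap (p : K[X][X]) (i j : ℤ) :
    bicoeff (Bivariate.swap p) i j = bicoeff p j i := by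
  have key : ∀ n m : ℕ, ((Bivariate.swap p).coeff n).coeff m = (p.coeff m).coeff n := by
    intro n m
    induction p using Polynomial.induction_on' with
    | add p q hp hq => simp [hp, hq]
    | monomial k f =>
      induction f using Polynomial.induction_on' with
      | add p q hp hq => simp only [map_add, coeff_add, hp, hq]
      | monomial l r =>
        rw [Bivariate.swap_monomial_monomial]
        simp only [coeff_monomial]
        split_ifs <;> simp_all [coeff_monomial]
  rcases lt_or_ge i 0 with hi | hi
  · rw [bicoeff_neg _ _ _ (Or.inl hi), bicoeff_neg _ _ _ (Or.inr hi)]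
  rcases lt_or_ge j 0 with hj | hj
  · rw [bicoeff_neg _ _ _ (Or.inr hj), bicoeff_neg _ _ _ (Or.inl hj)]
  obtain ⟨n, rfl⟩ : ∃ n : ℕ, i = (n : ℤ) := ⟨i.toNat, by omega⟩
  obtain ⟨m, rfl⟩ : ∃ m : ℕ, j = (m : ℤ) := ⟨j.toNat, by omega⟩
  rw [bicoeff_natCast, bicoeff_natCast, key]

theorem natDegree_le_iff_bicoeff (p : K[X][X]) (n : ℕ) :
    p.natDegree ≤ n ↔ ∀ i j : ℤ, (n : ℤ) < i → bicoeff p i j = 0 := by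
  constructor
  · intro h i j hi
    rcases lt_or_ge j 0 with hj | hj
    · exact bicoeff_neg _ _ _ (Or.inr hj)
    obtain ⟨k, rfl⟩ : ∃ k : ℕ, i = (k : ℤ) := ⟨i.toNat, by omega⟩
    obtain ⟨m, rfl⟩ : ∃ m : ℕ, j = (m : ℤ) := ⟨j.toNat, by omega⟩
    rw [bicoeff_natCast, coeff_eq_zero_of_natDegree_lt (lt_of_le_of_lt h (by exact_mod_cast hi)),
      coeff_zero]
  · intro h
    rw [natDegree_le_iff_coeff_eq_zero]
    intro N hN
    ext m
    rw [← bicoeff_natCast, h _ _ (by omega), coeff_zero]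

theorem natDegree_pvDer_le (δ : Der K) (t a c : K) (p : K[X][X]) :
    (pvDer δ t a c p).natDegree ≤ p.natDegree + 1 := by
  have h := (natDegree_le_iff_bicoeff p p.natDegree).1 le_rfl
  rw [natDegree_le_iff_bicoeff]
  intro i j hij
  push_cast at hij
  rw [bicoeff_pvDer, h (i - 1) _ (by omega), h (i - 1) _ (by omega), h i _ (by omega),
    h (i + 1) _ (by omega), h i _ (by omega)]
  simp

theorem natDegree_swap_pvDer_le (δ : Der K) (t a c : K) (p : K[X][X]) :
    (Bivariate.swap (pvDer δ t a c p)).natDegree ≤ (Bivariate.swap p).natDegree + 1 := by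
  have h := (natDegree_le_iff_bicoeff (Bivariate.swap p) _).1 le_rfl
  simp only [bicoeff_swap] at h
  rw [natDegree_le_iff_bicoeff]
  intro i j hij
  push_cast at hij
  rw [bicoeff_swap, bicoeff_pvDer, h (i - 1) _ (by omega), h i _ (by omega), h i _ (by omega),
    h i _ (by omega), h (i + 1) _ (by omega)]
  simp

theorem natDegree_cofactor_le {R : Type*} [CommRing R] [IsDomain R] {f g p : R[X]} (hf : f ≠ 0)
    (h : p = f * g) (hp : p.natDegree ≤ f.natDegree + 1) : g.natDegree ≤ 1 := by
  by_cases hg : g = 0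
  · simp [hg]
  rw [h, natDegree_mul hf hg] at hp
  omega

/-- The third Painlevé derivation has no nonconstant Darboux polynomials. -/
theorem exists_CC_of_dvd_pvDer [CharZero K] (δ : Der K) (t a c : K) (ht : t ≠ 0) (hδt : δ t = t)
    (hlin : ∀ s q r : ℤ, (a - 1) * s = c * q + (a - c) * r → s = 0 ∧ q = 0 ∧ r = 0)
    (f : K[X][X]) (hf : f ≠ 0) (h : f ∣ pvDer δ t a c f) : ∃ r, f = C (C r) := by
  obtain ⟨g, hg⟩ := h
  have hg1 : g.natDegree ≤ 1 :=
    natDegree_cofactor_le hf hg (natDegree_pvDer_le δ t a c f)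
  have hg2 : (Bivariate.swap g).natDegree ≤ 1 := by
    refine natDegree_cofactor_le (f := Bivariate.swap f) ?_ ?_ (natDegree_swap_pvDer_le δ t a c f)
    · simpa using hf
    · rw [hg, map_mul]
  rw [natDegree_le_iff_bicoeff] at hg2
  have hgi : ∀ n, (g.coeff n).natDegree ≤ 1 := by
    intro n
    rw [natDegree_le_iff_coeff_eq_zero]
    intro N hN
    rw [← bicoeff_natCast, ← bicoeff_swap]
    exact hg2 _ _ (by exact_mod_cast hN)
  obtain ⟨u, v, huv⟩ := exists_eq_X_add_C_of_natDegree_le_one hg1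
  have hu := hgi 1
  have hv := hgi 0
  rw [huv] at hu hv
  simp at hu hv
  obtain ⟨α, β, rfl⟩ := exists_eq_X_add_C_of_natDegree_le_one hu
  obtain ⟨ε, γ, rfl⟩ := exists_eq_X_add_C_of_natDegree_le_one hv
  refine exists_CC_of_pvDer_eq δ t a c ht hδt hlin (fun _ : Unit => f) α β ε (fun _ _ => γ)
    (fun _ => 0) (fun _ => rfl) ?_ ()
  intro _
  rw [hg, huv]
  simp only [map_add, map_mul, Finset.univ_unique, Finset.sum_singleton, map_zero]
  ring

theorem exists_pseudo_div {R : Type*} [CommRing R] [IsDomain R] (f : R[X]) (hf : f ≠ 0) (g : R[X]) :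
    ∃ (k : ℕ) (q r : R[X]), C (f.leadingCoeff ^ k) * g = q * f + r ∧ r.degree < f.degree := by
  induction hn : g.natDegree using Nat.strong_induction_on generalizing g with
  | _ n ih =>
    by_cases hlt : g.degree < f.degree
    · exact ⟨0, 0, g, by simp, hlt⟩
    rw [not_lt] at hlt
    have hg : g ≠ 0 := by
      rintro rfl
      rw [degree_zero, le_bot_iff, degree_eq_bot] at hlt
      exact hf hlt
    have hle : f.natDegree ≤ g.natDegree := natDegree_le_natDegree hlt
    let g' := C f.leadingCoeff * g - C g.leadingCoeff * X ^ (g.natDegree - f.natDegree) * f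
    have hlf : f.leadingCoeff ≠ 0 := leadingCoeff_ne_zero.2 hf
    have hlg : g.leadingCoeff ≠ 0 := leadingCoeff_ne_zero.2 hg
    have hdeg : g'.degree < g.degree := by
      have h1 : (C f.leadingCoeff * g).degree = g.degree := degree_C_mul hlf
      rw [← h1]
      apply degree_sub_lt_left
      · rw [h1, degree_mul, degree_C_mul_X_pow _ hlg, degree_eq_natDegree hf,
          degree_eq_natDegree hg]
        norm_cast; omega
      · exact mul_ne_zero (C_ne_zero.2 hlf) hg
      · rw [leadingCoeff_mul, leadingCoeff_mul, leadingCoeff_C, leadingCoeff_C_mul_X_pow, mul_comm]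
    by_cases hg' : g' = 0
    · refine ⟨1, C g.leadingCoeff * X ^ (g.natDegree - f.natDegree), 0, ?_, ?_⟩
      · rw [pow_one, add_zero]; exact sub_eq_zero.1 hg'
      · rw [degree_zero]; exact bot_lt_iff_ne_bot.2 (mt degree_eq_bot.1 hf)
    obtain ⟨k, q, r, h1, h2⟩ := ih g'.natDegree
      (by rw [← hn]; exact natDegree_lt_natDegree hg' hdeg) g' rfl
    refine ⟨k + 1, q + C (f.leadingCoeff ^ k) * (C g.leadingCoeff *
      X ^ (g.natDegree - f.natDegree)), r, ?_, h2⟩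
    rw [add_mul, pow_succ, C_mul]
    simp only [g'] at h1
    linear_combination h1

theorem Polynomial.IsPrimitive.dvd_of_dvd_C_mul {R : Type*} [CommRing R] [IsDomain R]
    [NormalizedGCDMonoid R] {f g : R[X]} (hf : f.IsPrimitive) {r : R} (hr : r ≠ 0)
    (h : f ∣ C r * g) : f ∣ g := by
  by_cases hg : g = 0
  · simp [hg]
  have h0 : C r * g ≠ 0 := mul_ne_zero (C_ne_zero.2 hr) hg
  rw [← hf.dvd_primPart_iff_dvd h0, (associated_primPart_mul h0).dvd_iff_dvd_right,
    (isUnit_primPart_C r).dvd_mul_left] at h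
  exact (hf.dvd_primPart_iff_dvd hg).1 h

/-- A nonzero ideal stable under a derivation without nonconstant Darboux polynomials contains a
nonzero polynomial in the inner variable. -/
theorem exists_C_mem_of_stable (Δ : Der K[X][X])
    (hΔ : ∀ f : K[X][X], f ≠ 0 → f ∣ Δ f → ∃ r, f = C (C r))
    (I : Ideal K[X][X]) (hI : I ≠ ⊥) (hst : ∀ f ∈ I, Δ f ∈ I) : ∃ h : K[X], h ≠ 0 ∧ C h ∈ I := by
  classical
  let _ : NormalizedGCDMonoid K[X] := Classical.choice inferInstance
  obtain ⟨f1, hf1, hf10⟩ := Submodule.exists_mem_ne_zero_of_ne_bot hI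
  obtain ⟨f, ⟨hf, hf0⟩, hmin⟩ : ∃ f, (f ∈ I ∧ f ≠ 0) ∧ ∀ g, (g ∈ I ∧ g ≠ 0) →
      f.natDegree ≤ g.natDegree := by
    have hne : {f | f ∈ I ∧ f ≠ 0}.Nonempty := ⟨f1, hf1, hf10⟩
    exact ⟨Function.argminOn natDegree _ hne, Function.argminOn_mem natDegree _ hne,
      fun g hg => Function.argminOn_le natDegree _ hg⟩
  have hdvd : ∀ g ∈ I, f.primPart ∣ g := by
    intro g hg
    obtain ⟨k, q, r, h1, h2⟩ := exists_pseudo_div f hf0 g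
    have hr : r = 0 := by
      by_contra hr
      have hrI : r ∈ I := by
        rw [eq_sub_of_add_eq' h1.symm]
        exact I.sub_mem (I.mul_mem_left _ hg) (I.mul_mem_left _ hf)
      have := hmin r ⟨hrI, hr⟩
      have h3 := natDegree_lt_natDegree hr h2
      omega
    rw [hr, add_zero] at h1
    apply (isPrimitive_primPart f).dvd_of_dvd_C_mul
      (pow_ne_zero k (leadingCoeff_ne_zero.2 hf0))
    rw [h1]
    exact (primPart_dvd f).mul_left q
  have hcont : f.content ≠ 0 := mt content_eq_zero_iff.1 hf0
  have h1 := hdvd _ (hst f hf)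
  have h2 : Δ f = C f.content * Δ f.primPart + f.primPart * Δ (C f.content) := by
    conv_lhs => rw [f.eq_C_content_mul_primPart, Derivation.leibniz]
    rfl
  rw [h2, dvd_add_left (dvd_mul_right f.primPart (Δ (C f.content)))] at h1
  obtain ⟨r, hr⟩ := hΔ f.primPart (primPart_ne_zero f)
    ((isPrimitive_primPart f).dvd_of_dvd_C_mul hcont h1)
  have hr0 : r ≠ 0 := by
    rintro rfl
    exact primPart_ne_zero f (by rw [hr]; simp)
  refine ⟨f.content * C r, mul_ne_zero hcont (C_ne_zero.2 hr0), ?_⟩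
  rw [C_mul, ← hr, ← eq_C_content_mul_primPart]
  exact hf

/-- A nonzero ideal stable under a derivation without nonconstant Darboux polynomials contains a
nonzero polynomial in the outer variable. -/
theorem exists_map_C_mem_of_stable (Δ : Der K[X][X])
    (hΔ : ∀ f : K[X][X], f ≠ 0 → f ∣ Δ f → ∃ r, f = C (C r))
    (I : Ideal K[X][X]) (hI : I ≠ ⊥) (hst : ∀ f ∈ I, Δ f ∈ I) :
    ∃ h : K[X], h ≠ 0 ∧ h.map C ∈ I := by
  let sw : K[X][X] ≃ₐ[K] K[X][X] := Bivariate.swap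
  have hsw : ∀ p, sw (sw p) = p := Bivariate.swap_swap_apply
  let Δ' : Der K[X][X] := Derivation.mk'
    (AddMonoidHom.toIntLinearMap
      { toFun := fun p => sw (Δ (sw p))
        map_zero' := by simp
        map_add' := by simp })
    (by
      intro p q
      change sw (Δ (sw (p * q))) = p * sw (Δ (sw q)) + q * sw (Δ (sw p))
      rw [map_mul, Derivation.leibniz, map_add, smul_eq_mul, smul_eq_mul, map_mul, map_mul,
        hsw, hsw])
  have hΔ'a : ∀ p, Δ' p = sw (Δ (sw p)) := fun _ => rfl
  obtain ⟨h, h0, hm⟩ := exists_C_mem_of_stable Δ'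
    (by
      intro f hf hd
      have h1 : sw f ∣ Δ (sw f) := by
        have := map_dvd sw hd
        rwa [hΔ'a, hsw] at this
      obtain ⟨r, hr⟩ := hΔ (sw f) (by simpa using hf) h1
      refine ⟨r, ?_⟩
      rw [← hsw f, hr]
      exact Bivariate.swap_C_C r)
    (I.comap sw)
    (by
      intro hbot
      apply hI
      rw [eq_bot_iff]
      intro f hf
      have h2 : sw f ∈ I.comap sw := by rw [Ideal.mem_comap, hsw]; exact hf
      rw [hbot, Submodule.mem_bot] at h2
      simpa using h2)
    (by
      intro f hf
      rw [Ideal.mem_comap] at hf ⊢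
      rw [hΔ'a, hsw]
      exact hst _ hf)
  refine ⟨h, h0, ?_⟩
  rw [Ideal.mem_comap] at hm
  rwa [← Bivariate.swap_C]

end Darboux

section Evaluation

variable {K L : Type*} [Field K] [Field L] [Algebra K L]

theorem algebraicIndependent_pair_iff (x y : L) :
    AlgebraicIndependent K ![x, y] ↔ ∀ p : K[X][X], aevalAeval (R := K) x y p = 0 → p = 0 := by
  rw [algebraicIndependent_iff]
  have key : ∀ p : K[X][X],
      MvPolynomial.aeval ![x, y] (Bivariate.equivMvPolynomial K p) = aevalAeval (R := K) x y p := by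
    intro p
    have : (MvPolynomial.aeval ![x, y]).comp (Bivariate.equivMvPolynomial K).toAlgHom =
        aevalAeval (R := K) x y := by
      ext <;> simp
    exact DFunLike.congr_fun this p
  constructor
  · intro h p hp
    have := h (Bivariate.equivMvPolynomial K p) (by rw [key, hp])
    simpa using this
  · intro h p hp
    have := h ((Bivariate.equivMvPolynomial K).symm p) (by rw [← key]; simpa using hp)
    simpa using this

theorem bivariate_induction {P : K[X][X] → Prop} (hadd : ∀ p q, P p → P q → P (p + q))
    (hmul : ∀ p q, P p → P q → P (p * q)) (hC : ∀ r, P (C (C r))) (hCX : P (C X)) (hX : P X)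
    (p : K[X][X]) : P p := by
  have hpow : ∀ q, P q → ∀ n : ℕ, P (q ^ n) := by
    intro q hq n
    induction n with
    | zero => simpa using hC 1
    | succ n ih => rw [pow_succ]; exact hmul _ _ ih hq
  have hCf : ∀ f : K[X], P (C f) := by
    intro f
    induction f using Polynomial.induction_on' with
    | add p q hp hq => rw [C_add]; exact hadd _ _ hp hq
    | monomial n r =>
      rw [← C_mul_X_pow_eq_monomial, C_mul, C_pow]
      exact hmul _ _ (hC r) (hpow _ hCX n)
  induction p using Polynomial.induction_on' with
  | add p q hp hq => exact hadd _ _ hp hq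
  | monomial n f =>
    rw [← C_mul_X_pow_eq_monomial]
    exact hmul _ _ (hCf f) (hpow _ hX n)

theorem aevalAeval_outer (x y : L) : aevalAeval (R := K) x y X = y := by simp

theorem aevalAeval_inner (x y : L) : aevalAeval (R := K) x y (C X) = x := by simp

theorem aevalAeval_CC (x y : L) (r : K) : aevalAeval (R := K) x y (C (C r)) = algebraMap K L r := by
  simp

@[simp] theorem outerDer_X : outerDer K X = 1 := by simp [outerDer]
@[simp] theorem outerDer_C (f : K[X]) : outerDer K (C f) = 0 := by simp [outerDer]
@[simp] theorem innerDer_X : innerDer K X = 0 := by simp [innerDer]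
@[simp] theorem innerDer_C (f : K[X]) : innerDer K (C f) = C (derivative f) := by simp [innerDer]

/-- Chain rule for a derivation applied to a polynomial in two elements. -/
theorem derivation_aevalAeval (d : Der K) (D : Der L)
    (hd : ∀ r, D (algebraMap K L r) = algebraMap K L (d r)) (x y : L) (p : K[X][X]) :
    D (aevalAeval (R := K) x y p) = aevalAeval (R := K) x y (d.coeffwise.coeffwise p)
      + aevalAeval (R := K) x y (outerDer K p) * D y
      + aevalAeval (R := K) x y (innerDer K p) * D x := by
  induction p using bivariate_induction with
  | hadd p q hp hq =>
    simp only [map_add, hp, hq]; ring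
  | hmul p q hp hq =>
    rw [map_mul, Derivation.leibniz, hp, hq]
    simp only [Derivation.leibniz, smul_eq_mul, map_add, map_mul]; ring
  | hC r => simp [hd]
  | hCX => simp
  | hX => simp

theorem aevalAeval_pvDer (d : Der K) (D : Der L)
    (hd : ∀ r, D (algebraMap K L r) = algebraMap K L (d r)) (t a c : K) (x y : L)
    (hy : D y = 2 * y ^ 2 * x - y ^ 2 + algebraMap K L a * y + algebraMap K L t)
    (hx : D x = -(2 * y * x ^ 2) + 2 * y * x - algebraMap K L a * x + algebraMap K L c)
    (p : K[X][X]) :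
    D (aevalAeval (R := K) x y p) = aevalAeval (R := K) x y (pvDer d t a c p) := by
  rw [derivation_aevalAeval d D hd, pvDer_apply, hy, hx, pvA, pvB]
  simp only [map_add, map_sub, map_mul, map_pow, map_ofNat, aevalAeval_outer, aevalAeval_inner,
    aevalAeval_CC]
  ring

/-- Strong minimality of the third Painlevé system. -/
theorem isAlgebraic_or_algebraicIndependent [CharZero K] (d : Der K) (D : Der L)
    (hd : ∀ r, D (algebraMap K L r) = algebraMap K L (d r)) (t a c : K) (ht : t ≠ 0) (hdt : d t = t)
    (hlin : ∀ s q r : ℤ, (a - 1) * s = c * q + (a - c) * r → s = 0 ∧ q = 0 ∧ r = 0) (x y : L)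
    (hy : D y = 2 * y ^ 2 * x - y ^ 2 + algebraMap K L a * y + algebraMap K L t)
    (hx : D x = -(2 * y * x ^ 2) + 2 * y * x - algebraMap K L a * x + algebraMap K L c) :
    (IsAlgebraic K x ∧ IsAlgebraic K y) ∨ AlgebraicIndependent K ![x, y] := by
  by_cases h : RingHom.ker (aevalAeval (R := K) x y) = ⊥
  · right
    rw [algebraicIndependent_pair_iff]
    intro p hp
    have : p ∈ RingHom.ker (aevalAeval (R := K) x y) := hp
    rwa [h] at this
  · left
    have hst : ∀ f ∈ RingHom.ker (aevalAeval (R := K) x y), pvDer d t a c f ∈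
        RingHom.ker (aevalAeval (R := K) x y) := by
      intro f hf
      rw [RingHom.mem_ker] at hf ⊢
      rw [← aevalAeval_pvDer d D hd t a c x y hy hx, hf, map_zero]
    obtain ⟨f, hf0, hf⟩ := exists_C_mem_of_stable _
      (exists_CC_of_dvd_pvDer d t a c ht hdt hlin) _ h hst
    obtain ⟨g, hg0, hg⟩ := exists_map_C_mem_of_stable _
      (exists_CC_of_dvd_pvDer d t a c ht hdt hlin) _ h hst
    rw [RingHom.mem_ker] at hf hg
    refine ⟨⟨f, hf0, by simpa using hf⟩, ⟨g, hg0, ?_⟩⟩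
    rw [← Bivariate.swap_C, Bivariate.aevalAeval_swap] at hg
    simpa using hg

end Evaluation

section Jacobian
variable {K : Type*} [Field K]

theorem Der.ext_bivariate {D E : Der K[X][X]} (hC : ∀ r, D (C (C r)) = E (C (C r)))
    (hCX : D (C X) = E (C X)) (hX : D X = E X) : D = E := by
  ext1 p
  induction p using bivariate_induction with
  | hadd p q hp hq => rw [map_add, map_add, hp, hq]
  | hmul p q hp hq => rw [Derivation.leibniz, Derivation.leibniz, hp, hq]
  | hC r => exact hC r
  | hCX => exact hCX
  | hX => exact hX

theorem exists_derivative_eq {R : Type*} [CommRing R] [Algebra ℚ R] (q : R[X]) :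
    ∃ p : R[X], derivative p = q := by
  induction q using Polynomial.induction_on' with
  | add p q hp hq =>
    obtain ⟨p', rfl⟩ := hp
    obtain ⟨q', rfl⟩ := hq
    exact ⟨p' + q', by simp⟩
  | monomial n r =>
    refine ⟨monomial (n + 1) (((n + 1 : ℚ)⁻¹) • r), ?_⟩
    rw [derivative_monomial, Nat.add_sub_cancel]
    congr 1
    have : (n + 1 : ℚ) ≠ 0 := by positivity
    rw [smul_mul_assoc, ← nsmul_eq_mul', ← Nat.cast_smul_eq_nsmul ℚ, smul_smul]
    push_cast
    rw [inv_mul_cancel₀ this, one_smul]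

theorem eq_CC_of_partials_eq_zero [CharZero K] (f : K[X][X]) (h1 : outerDer K f = 0)
    (h2 : innerDer K f = 0) : ∃ r, f = C (C r) := by
  have h3 : derivative f = 0 := h1
  obtain ⟨g, rfl⟩ := natDegree_eq_zero.1 (derivative_eq_zero.1 h3)
  rw [innerDer_C, C_eq_zero] at h2
  obtain ⟨r, rfl⟩ := natDegree_eq_zero.1 (derivative_eq_zero.1 h2)
  exact ⟨r, rfl⟩

theorem innerDer_outerDer_comm (p : K[X][X]) :
    innerDer K (outerDer K p) = outerDer K (innerDer K p) := by
  have : ⁅innerDer K, outerDer K⁆ = 0 := by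
    apply Der.ext_bivariate <;> simp [Derivation.commutator_apply]
  have h := DFunLike.congr_fun this p
  rw [Derivation.commutator_apply] at h
  exact sub_eq_zero.1 h

/-- A divergence-free polynomial vector field in the plane has a Hamiltonian. -/
theorem exists_potential [CharZero K] (ξ η : K[X][X]) (h : outerDer K ξ + innerDer K η = 0) :
    ∃ f, innerDer K f = ξ ∧ outerDer K f = -η := by
  obtain ⟨f0, hf0⟩ := exists_derivative_eq (-η)
  have hf0' : outerDer K f0 = -η := hf0
  have h1 : outerDer K (innerDer K f0 - ξ) = 0 := by
    rw [map_sub, ← innerDer_outerDer_comm, hf0', map_neg]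
    linear_combination -h
  have h2 : derivative (innerDer K f0 - ξ) = 0 := h1
  obtain ⟨g, hg⟩ := natDegree_eq_zero.1 (derivative_eq_zero.1 h2)
  obtain ⟨G, rfl⟩ := exists_derivative_eq g
  refine ⟨f0 - C G, ?_, ?_⟩
  · rw [map_sub, innerDer_C, hg]; ring
  · rw [map_sub, outerDer_C, hf0', sub_zero]

theorem Der.map_two {R : Type*} [CommRing R] (D : Der R) : D 2 = 0 := by
  exact_mod_cast D.map_natCast 2

theorem outerDer_pvA (t a : K) :
    outerDer K (pvA t a) = 4 * X * C X - 2 * X + C (C a) := by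
  simp only [pvA, map_add, map_sub, Derivation.leibniz, Derivation.leibniz_pow, outerDer_X,
    outerDer_C, Der.map_two, smul_eq_mul, nsmul_eq_mul]
  push_cast
  ring

theorem innerDer_pvA (t a : K) :
    innerDer K (pvA t a) = 2 * X ^ 2 := by
  simp only [pvA, map_add, map_sub, Derivation.leibniz, Derivation.leibniz_pow, innerDer_X,
    innerDer_C, Der.map_two, smul_eq_mul, nsmul_eq_mul, derivative_X, derivative_C, C_1, C_0]
  push_cast
  ring

theorem outerDer_pvB (a c : K) :
    outerDer K (pvB a c) = 2 * C X - 2 * C X ^ 2 := by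
  simp only [pvB, map_add, map_sub, Derivation.leibniz, Derivation.leibniz_pow, outerDer_X,
    outerDer_C, Der.map_two, smul_eq_mul, nsmul_eq_mul]
  push_cast
  ring

theorem innerDer_pvB (a c : K) :
    innerDer K (pvB a c) = -(4 * X * C X - 2 * X + C (C a)) := by
  simp only [pvB, map_add, map_sub, Derivation.leibniz, Derivation.leibniz_pow, innerDer_X,
    innerDer_C, Der.map_two, smul_eq_mul, nsmul_eq_mul, derivative_X, derivative_C, C_1, C_0]
  push_cast
  ring

theorem pvDer_CC (δ : Der K) (t a c r : K) : pvDer δ t a c (C (C r)) = C (C (δ r)) := by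
  simp [pvDer_apply]

theorem pvDer_CX (δ : Der K) (t a c : K) : pvDer δ t a c (C X) = pvB a c := by
  simp [pvDer_apply]

theorem pvDer_X (δ : Der K) (t a c : K) : pvDer δ t a c X = pvA t a := by
  simp [pvDer_apply]

theorem outerDer_pvDer (δ : Der K) (t a c : K) (p : K[X][X]) :
    outerDer K (pvDer δ t a c p) = pvDer δ t a c (outerDer K p)
      + outerDer K (pvA t a) * outerDer K p + outerDer K (pvB a c) * innerDer K p := by
  have : ⁅outerDer K, pvDer δ t a c⁆ =
      outerDer K (pvA t a) • outerDer K + outerDer K (pvB a c) • innerDer K := by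
    apply Der.ext_bivariate <;>
      simp [Derivation.commutator_apply, pvDer_CC, pvDer_CX, pvDer_X]
  have h := DFunLike.congr_fun this p
  rw [Derivation.commutator_apply, sub_eq_iff_eq_add] at h
  rw [h]
  simp only [Derivation.add_apply, Derivation.smul_apply, smul_eq_mul]
  ring

theorem innerDer_pvDer (δ : Der K) (t a c : K) (p : K[X][X]) :
    innerDer K (pvDer δ t a c p) = pvDer δ t a c (innerDer K p)
      + innerDer K (pvA t a) * outerDer K p + innerDer K (pvB a c) * innerDer K p := by
  have : ⁅innerDer K, pvDer δ t a c⁆ =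
      innerDer K (pvA t a) • outerDer K + innerDer K (pvB a c) • innerDer K := by
    apply Der.ext_bivariate <;>
      simp [Derivation.commutator_apply, pvDer_CC, pvDer_CX, pvDer_X]
  have h := DFunLike.congr_fun this p
  rw [Derivation.commutator_apply, sub_eq_iff_eq_add] at h
  rw [h]
  simp only [Derivation.add_apply, Derivation.smul_apply, smul_eq_mul]
  ring

/-- Constancy of solutions of linear systems over the third Painlevé derivation. -/
theorem exists_CC_of_pvDer_eq_sum [CharZero K] {ι : Type*} [Fintype ι]
    (δ : Der K) (t a c : K) (ht : t ≠ 0) (hδt : δ t = t)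
    (hlin : ∀ s q r : ℤ, (a - 1) * s = c * q + (a - c) * r → s = 0 ∧ q = 0 ∧ r = 0)
    (p : ι → K[X][X]) (M : ι → ι → K) (κ : ι → K)
    (h : ∀ j, pvDer δ t a c (p j) = C (C (κ j)) - ∑ i, C (C (M i j)) * p i) :
    ∀ j, ∃ r, p j = C (C r) := by
  refine exists_CC_of_pvDer_eq δ t a c ht hδt hlin p 0 0 0 (fun i j => -M i j) κ (by simp) ?_
  intro j
  have hneg : ∑ i, C (C (-M i j)) * p i = -∑ i, C (C (M i j)) * p i := by
    rw [← Finset.sum_neg_distrib]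
    exact Finset.sum_congr rfl fun i _ => by rw [map_neg, map_neg]; ring
  rw [h j, hneg]
  simp only [map_zero]
  ring

/-- A matrix of polynomials intertwining the linearised system with a traceless constant system
has linearly dependent columns. -/
theorem jacobian_degenerate [CharZero K] (δ : Der K) (t a c : K) (ht : t ≠ 0) (hδt : δ t = t)
    (hlin : ∀ s q r : ℤ, (a - 1) * s = c * q + (a - c) * r → s = 0 ∧ q = 0 ∧ r = 0)
    (P Q : Fin 2 → K[X][X]) (M : Fin 2 → Fin 2 → K) (hM : M 0 0 + M 1 1 = 0)
    (hP : ∀ j, pvDer δ t a c (P j) = outerDer K (pvA t a) * P j + innerDer K (pvA t a) * Q j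
      - ∑ i, C (C (M i j)) * P i)
    (hQ : ∀ j, pvDer δ t a c (Q j) = outerDer K (pvB a c) * P j + innerDer K (pvB a c) * Q j
      - ∑ i, C (C (M i j)) * Q i) :
    ∃ e0 e1 : K, (e0 ≠ 0 ∨ e1 ≠ 0) ∧ C (C e1) * P 0 = C (C e0) * P 1 ∧
      C (C e1) * Q 0 = C (C e0) * Q 1 := by
  have hdiv : ∀ j, ∃ r, outerDer K (P j) + innerDer K (Q j) = C (C r) := by
    refine exists_CC_of_pvDer_eq_sum δ t a c ht hδt hlin
      (fun j => outerDer K (P j) + innerDer K (Q j)) M (fun _ => 0) ?_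
    intro j
    have h1 := outerDer_pvDer δ t a c (P j)
    have h2 := innerDer_pvDer δ t a c (Q j)
    rw [hP] at h1
    rw [hQ] at h2
    simp only [map_add, map_sub, map_sum, Derivation.leibniz, smul_eq_mul, outerDer_C,
      innerDer_C, derivative_C, C_0, mul_zero, add_zero] at h1 h2
    have e1 : outerDer K (outerDer K (pvA t a)) + innerDer K (outerDer K (pvB a c)) = 0 := by
      rw [innerDer_outerDer_comm, ← map_add, outerDer_pvA, innerDer_pvB, add_neg_cancel, map_zero]
    have e2 : outerDer K (innerDer K (pvA t a)) + innerDer K (innerDer K (pvB a c)) = 0 := by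
      rw [← innerDer_outerDer_comm, ← map_add, outerDer_pvA, innerDer_pvB, add_neg_cancel,
        map_zero]
    simp only [map_add, mul_add, Finset.sum_add_distrib, map_zero]
    linear_combination -h1 - h2 + P j * e1 + Q j * e2
  choose d hd using hdiv
  by_cases hd0 : d = 0
  · refine ⟨1, 0, Or.inl one_ne_zero, ?_⟩
    have hpot : ∀ j, ∃ f, innerDer K f = P j ∧ outerDer K f = -Q j := by
      intro j
      exact exists_potential _ _ (by rw [hd, hd0]; simp)
    choose I hI1 hI2 using hpot
    have hκ : ∀ j, ∃ r, pvDer δ t a c (I j) + ∑ i, C (C (M i j)) * I i = C (C r) := by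
      intro j
      apply eq_CC_of_partials_eq_zero
      · simp only [map_add, map_sum, Derivation.leibniz, smul_eq_mul, outerDer_C, mul_zero,
          add_zero, outerDer_pvDer, hI1, hI2, map_neg, hQ j]
        rw [outerDer_pvA, innerDer_pvB, Fin.sum_univ_two, Fin.sum_univ_two]
        ring
      · simp only [map_add, map_sum, Derivation.leibniz, smul_eq_mul, innerDer_C, derivative_C,
          C_0, mul_zero, add_zero, innerDer_pvDer, hI1, hI2, hP j]
        rw [outerDer_pvA, innerDer_pvB]
        ring
    choose κ hκ using hκ
    have hc := exists_CC_of_pvDer_eq_sum δ t a c ht hδt hlin I M κ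
      (fun j => by rw [← hκ j]; ring)
    have hP0 : ∀ j, P j = 0 := fun j => by
      obtain ⟨r, hr⟩ := hc j
      rw [← hI1, hr]; simp
    have hQ0 : ∀ j, Q j = 0 := fun j => by
      obtain ⟨r, hr⟩ := hc j
      rw [← neg_eq_zero, ← hI2, hr]; simp
    simp [hP0, hQ0]
  · refine ⟨d 0, d 1, ?_, ?_⟩
    · by_contra! hcon
      apply hd0
      ext i
      fin_cases i
      · exact hcon.1
      · exact hcon.2
    have hdδ : ∀ j, C (C (δ (d j))) = - ∑ i, (C (C (M i j)) * C (C (d i)) : K[X][X]) := by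
      intro j
      have h1 := outerDer_pvDer δ t a c (P j)
      have h2 := innerDer_pvDer δ t a c (Q j)
      rw [hP] at h1
      rw [hQ] at h2
      simp only [map_add, map_sub, map_sum, Derivation.leibniz, smul_eq_mul, outerDer_C,
        innerDer_C, derivative_C, C_0, mul_zero, add_zero] at h1 h2
      have e1 : outerDer K (outerDer K (pvA t a)) + innerDer K (outerDer K (pvB a c)) = 0 := by
        rw [innerDer_outerDer_comm, ← map_add, outerDer_pvA, innerDer_pvB, add_neg_cancel, map_zero]
      have e2 : outerDer K (innerDer K (pvA t a)) + innerDer K (innerDer K (pvB a c)) = 0 := by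
        rw [← innerDer_outerDer_comm, ← map_add, outerDer_pvA, innerDer_pvB, add_neg_cancel,
          map_zero]
      rw [← pvDer_CC δ t a c, ← hd]
      simp only [← hd, map_add, mul_add, Finset.sum_add_distrib]
      linear_combination -h1 - h2 + P j * e1 + Q j * e2
    obtain ⟨I, hI1, hI2⟩ := exists_potential (C (C (d 1)) * P 0 - C (C (d 0)) * P 1)
      (C (C (d 1)) * Q 0 - C (C (d 0)) * Q 1) (by
        have h0 := hd 0
        have h1 := hd 1
        simp only [map_sub, Derivation.leibniz, smul_eq_mul, outerDer_C, innerDer_C, derivative_C,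
          C_0, mul_zero, add_zero]
        linear_combination C (C (d 1)) * h0 - C (C (d 0)) * h1)
    have hM' : C (C (M 0 0)) + C (C (M 1 1)) = (0 : K[X][X]) := by
      rw [← C_add, ← C_add, hM, C_0, C_0]
    have hδ0 := hdδ 0
    have hδ1 := hdδ 1
    have hP0 := hP 0
    have hP1 := hP 1
    have hQ0 := hQ 0
    have hQ1 := hQ 1
    rw [Fin.sum_univ_two] at hδ0 hδ1 hP0 hP1 hQ0 hQ1
    have hκ : ∃ r, pvDer δ t a c I = C (C r) := by
      apply eq_CC_of_partials_eq_zero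
      · rw [outerDer_pvDer, hI2, hI1]
        simp only [map_neg, map_sub, Derivation.leibniz, smul_eq_mul, pvDer_CC,
          hQ0, hQ1, hδ0, hδ1]
        rw [outerDer_pvA, innerDer_pvB]
        linear_combination (C (C (d 1)) * Q 0 - C (C (d 0)) * Q 1) * hM'
      · rw [innerDer_pvDer, hI2, hI1]
        simp only [map_sub, Derivation.leibniz, smul_eq_mul, pvDer_CC, hP0, hP1,
          hδ0, hδ1]
        rw [outerDer_pvA, innerDer_pvB]
        linear_combination -(C (C (d 1)) * P 0 - C (C (d 0)) * P 1) * hM'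
    obtain ⟨κ, hκ⟩ := hκ
    obtain ⟨r, hr⟩ := exists_CC_of_pvDer_eq_sum δ t a c ht hδt hlin (fun _ : Unit => I)
      (fun _ _ => 0) (fun _ => κ) (fun _ => by simp [hκ]) ()
    constructor
    · rw [← sub_eq_zero, ← hI1, hr]; simp
    · rw [← sub_eq_zero, ← neg_eq_zero, ← hI2, hr]; simp

end Jacobian

section FiniteModules
variable {K F : Type*} [Field K] [Field F] [Algebra K F]

theorem derivation_mem_span (A : Subalgebra K F) (δ : Der F) (hA : ∀ a ∈ A, δ a ∈ A)
    {G : Set F} {N : Submodule A F} (hN : G ⊆ N) (hG : ∀ g ∈ G, δ g ∈ N) {b : F}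
    (hb : b ∈ Submodule.span A G) : δ b ∈ N := by
  have hGN : Submodule.span A G ≤ N := Submodule.span_le.2 hN
  induction hb using Submodule.span_induction with
  | mem g hg => exact hG g hg
  | zero => rw [map_zero]; exact N.zero_mem
  | add u v _ _ hu hv => rw [map_add]; exact N.add_mem hu hv
  | smul a u hu hu' =>
    have h1 : δ (a • u) = a • δ u + (⟨δ a, hA a a.2⟩ : A) • u := by
      simp only [Subalgebra.smul_def, smul_eq_mul, Derivation.leibniz]
      ring
    rw [h1]
    exact N.add_mem (N.smul_mem _ hu') (N.smul_mem _ (hGN hu))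

/-- A finitely generated differential submodule has, up to a stable nonzero ideal, only integral
elements. -/
theorem exists_ideal_isIntegral (A : Subalgebra K F) (δ : Der F) (hA : ∀ a ∈ A, δ a ∈ A)
    (halg : Algebra.IsAlgebraic A F) (G : Finset F)
    (hG : ∀ g ∈ G, δ g ∈ Submodule.span A (G : Set F)) :
    ∃ I : Ideal A, I ≠ ⊥ ∧ (∀ s ∈ I, (⟨δ s, hA s s.2⟩ : A) ∈ I) ∧
      ∀ s ∈ I, ∀ b ∈ Submodule.span A (G : Set F), IsIntegral A ((s : F) * b) := by
  classical
  set G₁ : Finset F := insert 1 G with hG₁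
  set M : Submodule A F := Submodule.span A (G₁ : Set F) with hM
  have hsub : Submodule.span A (G : Set F) ≤ M := by
    apply Submodule.span_mono
    rw [hG₁, Finset.coe_insert]
    exact Set.subset_insert _ _
  have h1M : (1 : F) ∈ M := Submodule.subset_span (by simp [hG₁])
  have hMst : ∀ m ∈ M, δ m ∈ M := by
    intro m hm
    refine derivation_mem_span A δ hA Submodule.subset_span ?_ hm
    intro g hg
    rw [hG₁, Finset.coe_insert] at hg
    rcases hg with rfl | hg
    · rw [Derivation.map_one_eq_zero]; exact M.zero_mem
    · exact hsub (hG g hg)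
  have hpow : ∀ n : ℕ, ∀ m ∈ M ^ n, δ m ∈ M ^ n := by
    intro n
    induction n with
    | zero =>
      intro m hm
      rw [pow_zero, Submodule.mem_one] at hm ⊢
      obtain ⟨a, rfl⟩ := hm
      exact ⟨⟨δ a, hA a a.2⟩, rfl⟩
    | succ n ih =>
      intro m hm
      rw [pow_succ] at hm ⊢
      induction hm using Submodule.mul_induction_on' with
      | mem_mul_mem u hu v hv =>
        rw [Derivation.leibniz, smul_eq_mul, smul_eq_mul]
        refine Submodule.add_mem _ (Submodule.mul_mem_mul hu (hMst v hv)) ?_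
        rw [mul_comm v]
        exact Submodule.mul_mem_mul (ih u hu) hv
      | add u _ v _ hu hv => rw [map_add]; exact Submodule.add_mem _ hu hv
  have hmono : Monotone fun n : ℕ => M ^ n := by
    apply monotone_nat_of_le_succ
    intro n m hm
    rw [pow_succ, ← mul_one m]
    exact Submodule.mul_mem_mul hm h1M
  obtain ⟨d, hd0, hd⟩ := Algebra.IsAlgebraic.exists_integral_multiples A G₁
  set B : Subalgebra A F := Algebra.adjoin A ((fun g => d • g) '' (G₁ : Set F)) with hB
  have hBfg : (Subalgebra.toSubmodule B).FG := by
    apply fg_adjoin_of_finite (G₁.finite_toSet.image _)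
    rintro _ ⟨g, hg, rfl⟩
    exact hd g hg
  have hBM : ∀ b ∈ B, ∃ n : ℕ, b ∈ M ^ n := by
    intro b hb
    induction hb using Algebra.adjoin_induction with
    | mem b hb =>
      obtain ⟨g, hg, rfl⟩ := hb
      exact ⟨1, by rw [pow_one]; exact M.smul_mem _ (Submodule.subset_span hg)⟩
    | algebraMap r => exact ⟨0, by rw [pow_zero]; exact Submodule.mem_one.2 ⟨r, rfl⟩⟩
    | add u v _ _ hu hv =>
      obtain ⟨n, hn⟩ := hu
      obtain ⟨m, hm⟩ := hv
      exact ⟨n + m, Submodule.add_mem _ (hmono (Nat.le_add_right n m) hn)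
        (hmono (Nat.le_add_left m n) hm)⟩
    | mul u v _ _ hu hv =>
      obtain ⟨n, hn⟩ := hu
      obtain ⟨m, hm⟩ := hv
      exact ⟨n + m, by rw [pow_add]; exact Submodule.mul_mem_mul hn hm⟩
  obtain ⟨n, hn⟩ : ∃ n : ℕ, Subalgebra.toSubmodule B ≤ M ^ n := by
    obtain ⟨T, hT⟩ := hBfg
    choose f hf using fun b : T => hBM b (by
      have : (b : F) ∈ Subalgebra.toSubmodule B := hT ▸ Submodule.subset_span b.2
      exact this)
    refine ⟨T.attach.sup f, ?_⟩
    rw [← hT, Submodule.span_le]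
    intro b hb
    exact hmono (Finset.le_sup (f := f) (Finset.mem_attach T ⟨b, hb⟩)) (hf ⟨b, hb⟩)
  have hdM : ∀ m ∈ M, d • m ∈ B := by
    intro m hm
    have h1 : M ≤ (Subalgebra.toSubmodule B).comap (d • LinearMap.id) := by
      rw [hM, Submodule.span_le]
      intro g hg
      exact Algebra.subset_adjoin ⟨g, hg, rfl⟩
    exact h1 hm
  have hdpow : ∀ k : ℕ, ∀ m ∈ M ^ k, d ^ k • m ∈ B := by
    intro k
    induction k with
    | zero =>
      intro m hm
      rw [pow_zero, Submodule.mem_one] at hm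
      obtain ⟨a, rfl⟩ := hm
      rw [pow_zero, one_smul]
      exact B.algebraMap_mem a
    | succ k ih =>
      intro m hm
      rw [pow_succ] at hm
      induction hm using Submodule.mul_induction_on' with
      | mem_mul_mem u hu v hv =>
        rw [pow_succ, ← smul_mul_smul_comm]
        exact B.mul_mem (ih u hu) (hdM v hv)
      | add u _ v _ hu hv => rw [smul_add]; exact B.add_mem hu hv
  refine ⟨(M ^ n).colon (M ^ (n + 1) : Submodule A F), ?_, ?_, ?_⟩
  · intro hbot
    have : d ^ (n + 1) ∈ (M ^ n).colon (M ^ (n + 1) : Submodule A F) := by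
      rw [Submodule.mem_colon]
      intro m hm
      exact hn (hdpow (n + 1) m hm)
    rw [hbot, Submodule.mem_bot] at this
    exact pow_ne_zero _ hd0 this
  · intro s hs
    rw [Submodule.mem_colon] at hs ⊢
    intro m hm
    have h1 : (⟨δ s, hA s s.2⟩ : A) • m = δ (s • m) - s • δ m := by
      simp only [Subalgebra.smul_def, smul_eq_mul, Derivation.leibniz]
      ring
    rw [h1]
    exact Submodule.sub_mem _ (hpow n _ (hs m hm)) (hs _ (hpow (n + 1) m hm))
  · intro s hs b hb
    rw [Submodule.mem_colon] at hs
    have h1n : (1 : F) ∈ M ^ n := hmono (Nat.zero_le n) (by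
      change (1 : F) ∈ M ^ 0
      rw [pow_zero]; exact Submodule.mem_one.2 ⟨1, map_one _⟩)
    refine isIntegral_of_smul_mem_submodule (M ^ n) ?_ ?_ _ ?_
    · intro hbot
      rw [hbot, Submodule.mem_bot] at h1n
      exact one_ne_zero h1n
    · exact Submodule.FG.pow ⟨G₁, rfl⟩ n
    · intro m hm
      have h2 := hs (m * b) (by rw [pow_succ]; exact Submodule.mul_mem_mul hm (hsub hb))
      rw [smul_eq_mul, mul_assoc, mul_comm b m]
      exact h2

/-- Elements of finitely generated differential modules over a bivariate polynomial ring without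
Darboux polynomials are integral up to a polynomial in one variable. -/
theorem exists_isIntegral_of_mem_span (x y : F) (δ : Der F) (Δ : Der K[X][X])
    (hcompat : ∀ p, δ (aevalAeval (R := K) x y p) = aevalAeval (R := K) x y (Δ p))
    (hΔ : ∀ f : K[X][X], f ≠ 0 → f ∣ Δ f → ∃ r, f = C (C r))
    (halg : Algebra.IsAlgebraic (aevalAeval (R := K) x y).range F) (G : Finset F)
    (hG : ∀ g ∈ G, δ g ∈ Submodule.span (aevalAeval (R := K) x y).range (G : Set F))
    (b : F) (hb : b ∈ Submodule.span (aevalAeval (R := K) x y).range (G : Set F)) :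
    (∃ h : K[X], h ≠ 0 ∧ IsIntegral (aevalAeval (R := K) x y).range (aeval x h * b)) ∧
    (∃ h : K[X], h ≠ 0 ∧ IsIntegral (aevalAeval (R := K) x y).range (aeval y h * b)) := by
  have hA : ∀ a ∈ (aevalAeval (R := K) x y).range, δ a ∈ (aevalAeval (R := K) x y).range := by
    rintro _ ⟨p, rfl⟩
    exact ⟨Δ p, (hcompat p).symm⟩
  obtain ⟨I, hI0, hIst, hI⟩ := exists_ideal_isIntegral _ δ hA halg G hG
  set J : Ideal K[X][X] := I.comap (aevalAeval (R := K) x y).rangeRestrict with hJ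
  have hJ0 : J ≠ ⊥ := by
    obtain ⟨⟨_, p, rfl⟩, hp, hp0⟩ := Submodule.exists_mem_ne_zero_of_ne_bot hI0
    intro hbot
    have : p ∈ J := hp
    rw [hbot, Submodule.mem_bot] at this
    apply hp0
    ext
    simp [this]
  have hJst : ∀ f ∈ J, Δ f ∈ J := by
    intro f hf
    have h1 := hIst _ hf
    rw [hJ, Ideal.mem_comap]
    convert h1 using 1
    ext
    exact (hcompat f).symm
  obtain ⟨h, h0, hm⟩ := exists_C_mem_of_stable Δ hΔ J hJ0 hJst
  obtain ⟨h', h0', hm'⟩ := exists_map_C_mem_of_stable Δ hΔ J hJ0 hJst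
  refine ⟨⟨h, h0, ?_⟩, ⟨h', h0', ?_⟩⟩
  · have := hI _ hm b hb
    simpa using this
  · have := hI _ hm' b hb
    have h1 : aevalAeval (R := K) x y (h'.map C) = aeval y h' := by
      rw [← Bivariate.swap_C, Bivariate.aevalAeval_swap]
      simp
    rw [← h1]
    exact this

end FiniteModules

section Valuation
open IsDedekindDomain WithZero

variable {S E : Type*} [CommRing S] [IsDedekindDomain S] [Field E] [Algebra S E]
  [IsFractionRing S E]

theorem exists_unit_mul_pow (v : HeightOneSpectrum S) {ϖ : E}
    (hϖ : v.valuation E ϖ = exp (-1 : ℤ)) {x : E} (hx0 : x ≠ 0) (hx : v.valuation E x ≤ 1) :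
    ∃ (η : E) (n : ℕ), v.valuation E η = 1 ∧ x = η * ϖ ^ n := by
  have hv0 : v.valuation E x ≠ 0 := (Valuation.ne_zero_iff _).2 hx0
  have hϖ0 : ϖ ≠ 0 := by
    rintro rfl
    rw [map_zero] at hϖ
    exact exp_ne_zero hϖ.symm
  obtain ⟨n, hn⟩ : ∃ n : ℕ, v.valuation E x = exp (-(n : ℤ)) := by
    refine ⟨(-log (v.valuation E x)).toNat, ?_⟩
    have : log (v.valuation E x) ≤ 0 := by
      rw [log_le_iff_le_exp hv0, exp_zero]; exact hx
    rw [Int.toNat_of_nonneg (by omega), neg_neg, exp_log hv0]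
  refine ⟨x / ϖ ^ n, n, ?_, by field_simp⟩
  rw [map_div₀, map_pow, hn, hϖ, ← exp_nsmul]
  simp

/-- A derivation which is logarithmic at a tamely ramified place preserves the valuation ring. -/
theorem valuation_derivation_le_one (v : HeightOneSpectrum S) (θ : Der E) (π : E)
    (hπ0 : π ≠ 0) (hπ : v.valuation E π < 1) (hθπ : θ π = -π)
    (hnat : ∀ n : ℕ, n ≠ 0 → v.valuation E n = 1) (Γ : ℤᵐ⁰)
    (hbd : ∀ s : S, v.valuation E (θ (algebraMap S E s)) ≤ max 1 Γ)
    (hres : ∃ h : E, v.valuation E h < 1 ∧ v.valuation E (θ h) = Γ)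
    {x : E} (hx : v.valuation E x ≤ 1) : v.valuation E (θ x) ≤ 1 := by
  have hV : ∀ x, v.valuation E x ≤ 1 → v.valuation E (θ x) ≤ max 1 Γ := by
    intro x hx
    obtain ⟨n, d, hnd⟩ := v.exists_primeCompl_mul_eq_of_integer x hx
    have hd : v.valuation E (algebraMap S E d) = 1 := by
      rw [v.valuation_of_algebraMap, v.intValuation_eq_one_iff_mem_primeCompl]
      exact d.2
    have h1 : θ x * algebraMap S E d = θ (algebraMap S E n) - x * θ (algebraMap S E d) := by
      rw [← hnd, Derivation.leibniz, smul_eq_mul, smul_eq_mul]; ring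
    have h2 : v.valuation E (θ x) = v.valuation E (θ x * algebraMap S E d) := by
      rw [map_mul, hd, mul_one]
    rw [h2, h1]
    refine (Valuation.map_sub _ _ _).trans (max_le (hbd n) ?_)
    rw [map_mul]
    exact mul_le_of_le_one_of_le hx (hbd d)
  rcases le_or_gt Γ 1 with hΓ | hΓ
  · exact (hV x hx).trans (max_le le_rfl hΓ)
  exfalso
  have hV' : ∀ x, v.valuation E x ≤ 1 → v.valuation E (θ x) ≤ Γ := by
    intro x hx
    exact (hV x hx).trans (max_le hΓ.le le_rfl)
  obtain ⟨ϖ, hϖ⟩ := v.valuation_exists_uniformizer E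
  have hϖ0 : ϖ ≠ 0 := by
    rintro rfl
    rw [map_zero] at hϖ
    exact exp_ne_zero hϖ.symm
  have hϖ1 : v.valuation E ϖ < 1 := by
    rw [hϖ, ← exp_zero, exp_lt_exp]; norm_num
  have hθϖ : v.valuation E (θ ϖ) ≤ v.valuation E ϖ * Γ := by
    obtain ⟨η, n, hη, hn⟩ := exists_unit_mul_pow v hϖ hπ0 hπ.le
    obtain ⟨m, rfl⟩ : ∃ m, n = m + 1 := by
      refine Nat.exists_eq_succ_of_ne_zero ?_
      rintro rfl
      rw [hn, pow_zero, mul_one, hη] at hπ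
      exact lt_irrefl _ hπ
    have h1 : ((m + 1 : ℕ) : E) * η * θ ϖ = -((η + θ η) * ϖ) := by
      have h2 := hθπ
      rw [hn, Derivation.leibniz, Derivation.leibniz_pow] at h2
      simp only [smul_eq_mul, nsmul_eq_mul, Nat.add_sub_cancel] at h2
      apply mul_right_cancel₀ (pow_ne_zero m hϖ0)
      rw [pow_succ] at h2
      linear_combination h2
    have h3 := congrArg (v.valuation E) h1
    rw [map_mul, map_mul, hnat _ (Nat.succ_ne_zero m), hη, one_mul, one_mul, Valuation.map_neg,
      map_mul] at h3
    rw [h3, mul_comm]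
    refine mul_le_mul_right ?_ _
    exact (Valuation.map_add _ _ _).trans (max_le (hη.le.trans hΓ.le) (hV' η hη.le))
  obtain ⟨h, hh, hθh⟩ := hres
  have hh0 : h ≠ 0 := by
    rintro rfl
    rw [map_zero, map_zero] at hθh
    rw [← hθh] at hΓ
    exact not_lt_zero hΓ
  obtain ⟨η, n, hη, hn⟩ := exists_unit_mul_pow v hϖ hh0 hh.le
  obtain ⟨m, rfl⟩ : ∃ m, n = m + 1 := by
    refine Nat.exists_eq_succ_of_ne_zero ?_
    rintro rfl
    rw [hn, pow_zero, mul_one, hη] at hh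
    exact lt_irrefl _ hh
  have h1 : θ h = ϖ ^ m * (ϖ * θ η + ((m + 1 : ℕ) : E) * η * θ ϖ) := by
    rw [hn, Derivation.leibniz, Derivation.leibniz_pow]
    simp only [smul_eq_mul, nsmul_eq_mul, Nat.add_sub_cancel]
    ring
  have h2 : v.valuation E (θ h) ≤ v.valuation E ϖ * Γ := by
    rw [h1, map_mul, map_pow]
    refine mul_le_of_le_one_of_le (pow_le_one₀ zero_le hϖ1.le) ?_
    refine (Valuation.map_add _ _ _).trans (max_le ?_ ?_)
    · rw [map_mul]
      exact mul_le_mul_right (hV' η hη.le) _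
    · rw [map_mul, map_mul, hnat _ (Nat.succ_ne_zero m), hη, one_mul, one_mul]
      exact hθϖ
  rw [hθh] at h2
  have h3 : v.valuation E ϖ * Γ < Γ := by
    exact mul_lt_of_lt_one_left (zero_lt_one.trans hΓ) hϖ1
  exact absurd h2 (not_le.2 h3)

theorem valuation_le_one_of_isIntegralElem {R Γ₀ : Type*} [CommRing R]
    [LinearOrderedCommGroupWithZero Γ₀] (v : Valuation E Γ₀) (f : R →+* E)
    (hf : ∀ r, v (f r) ≤ 1) {x : E} (hx : f.IsIntegralElem x) : v x ≤ 1 := by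
  have h1 : IsIntegral v.integer x := by
    obtain ⟨p, hp, hpx⟩ := hx
    refine ⟨p.map (f.codRestrict v.integer hf), hp.map _, ?_⟩
    rw [eval₂_map]
    exact hpx
  exact (Valuation.integer.integers v).mem_of_integral h1

theorem derivation_eval₂ {R : Type*} [CommRing R] (θ : Der E) (f : R →+* E)
    (hf : ∀ r, θ (f r) = 0) (x : E) (p : R[X]) :
    θ (eval₂ f x p) = eval₂ f x (derivative p) * θ x := by
  induction p using Polynomial.induction_on' with
  | add p q hp hq => simp only [eval₂_add, map_add, hp, hq, add_mul]
  | monomial n r =>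
    rw [eval₂_monomial, derivative_monomial, eval₂_monomial, Derivation.leibniz,
      Derivation.leibniz_pow, hf]
    simp only [smul_eq_mul, nsmul_eq_mul, map_mul, map_natCast, mul_zero, add_zero]
    ring

end Valuation

section Nilpotence
open IsDedekindDomain WithZero

variable {k E : Type*} [Field k] [Field E] [Algebra k[X] E]

theorem algebraMap_X_ne_zero [Algebra (RatFunc k) E] [IsScalarTower k[X] (RatFunc k) E] :
    algebraMap k[X] E X ≠ 0 := by
  rw [IsScalarTower.algebraMap_apply k[X] (RatFunc k) E, Ne, map_eq_zero, RatFunc.algebraMap_X]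
  exact RatFunc.X_ne_zero

theorem valuation_algebraMap_le_one [IsDedekindDomain (integralClosure k[X] E)]
    [IsFractionRing (integralClosure k[X] E) E]
    (v : HeightOneSpectrum (integralClosure k[X] E)) (p : k[X]) :
    v.valuation E (algebraMap k[X] E p) ≤ 1 :=
  v.valuation_le_one (algebraMap k[X] (integralClosure k[X] E) p)

theorem valuation_C [IsDedekindDomain (integralClosure k[X] E)]
    [IsFractionRing (integralClosure k[X] E) E]
    (v : HeightOneSpectrum (integralClosure k[X] E)) {c : k} (hc : c ≠ 0) :
    v.valuation E (algebraMap k[X] E (C c)) = 1 := by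
  apply le_antisymm (valuation_algebraMap_le_one v _)
  have h1 : v.valuation E (algebraMap k[X] E (C c)) *
      v.valuation E (algebraMap k[X] E (C c⁻¹)) = 1 := by
    rw [← map_mul, ← map_mul, ← C_mul, mul_inv_cancel₀ hc, C_1, map_one, map_one]
  rw [← h1]
  exact mul_le_of_le_one_right' (valuation_algebraMap_le_one v _)

theorem derivation_algebraMap_polynomial (θ : Der E)
    (hC : ∀ c : k, θ (algebraMap k[X] E (C c)) = 0) (p : k[X]) :
    θ (algebraMap k[X] E p) =
      algebraMap k[X] E (derivative p) * θ (algebraMap k[X] E X) := by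
  have h := derivation_eval₂ θ ((algebraMap k[X] E).comp C) hC (algebraMap k[X] E X)
  have h2 : ∀ q : k[X], eval₂ ((algebraMap k[X] E).comp C) (algebraMap k[X] E X) q =
      algebraMap k[X] E q := by
    intro q
    rw [← hom_eval₂, eval₂_C_X]
  simpa only [h2] using h p

theorem exists_residue_annihilator [CharZero k] [IsDedekindDomain (integralClosure k[X] E)]
    [IsFractionRing (integralClosure k[X] E) E]
    (v : HeightOneSpectrum (integralClosure k[X] E))
    (hπ : v.valuation E (algebraMap k[X] E X) < 1) (s : integralClosure k[X] E) :
    ∃ p : k[X], v.valuation E (eval₂ ((algebraMap k[X] E).comp C) s p) < 1 ∧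
      v.valuation E (eval₂ ((algebraMap k[X] E).comp C) s (derivative p)) = 1 := by
  have := v.isMaximal
  let _ : Field (integralClosure k[X] E ⧸ v.asIdeal) := Ideal.Quotient.field _
  let ρ : k →+* integralClosure k[X] E ⧸ v.asIdeal :=
    ((Ideal.Quotient.mk v.asIdeal).comp (algebraMap k[X] (integralClosure k[X] E))).comp C
  let _ : Algebra k (integralClosure k[X] E ⧸ v.asIdeal) := ρ.toAlgebra
  have hX : Ideal.Quotient.mk v.asIdeal (algebraMap k[X] (integralClosure k[X] E) X) = 0 := by
    rw [Ideal.Quotient.eq_zero_iff_mem, ← v.valuation_lt_one_iff_mem (K := E)]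
    exact hπ
  have hρ : ∀ q : k[X],
      Ideal.Quotient.mk v.asIdeal (algebraMap k[X] (integralClosure k[X] E) q) = ρ (q.coeff 0) := by
    intro q
    conv_lhs => rw [← divX_mul_X_add q, map_add, map_add, map_mul, map_mul, hX, mul_zero, zero_add]
    rfl
  have hev : ∀ p : k[X], eval₂ ((algebraMap k[X] E).comp C) s p =
      algebraMap (integralClosure k[X] E) E
        (eval₂ ((algebraMap k[X] (integralClosure k[X] E)).comp C) s p) := by
    intro p
    rw [hom_eval₂]
    rfl
  have hmk : ∀ p : k[X], Ideal.Quotient.mk v.asIdeal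
      (eval₂ ((algebraMap k[X] (integralClosure k[X] E)).comp C) s p) =
      aeval (Ideal.Quotient.mk v.asIdeal s) p := by
    intro p
    rw [hom_eval₂]
    rfl
  have hbint : IsIntegral k (Ideal.Quotient.mk v.asIdeal s) := by
    obtain ⟨q, hq, hqs⟩ : IsIntegral k[X] s := integralClosure.isIntegral s
    refine ⟨q.map (constantCoeff), hq.map _, ?_⟩
    have h1 := congrArg (Ideal.Quotient.mk v.asIdeal) hqs
    rw [hom_eval₂, map_zero] at h1
    rw [eval₂_map, ← h1]
    congr 1
    apply RingHom.ext
    intro q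
    exact (hρ q).symm
  refine ⟨minpoly k (Ideal.Quotient.mk v.asIdeal s), ?_, ?_⟩
  · rw [hev, v.valuation_lt_one_iff_mem, ← Ideal.Quotient.eq_zero_iff_mem, hmk, minpoly.aeval]
  · rw [hev, v.valuation_eq_one_iff_notMem, ← Ideal.Quotient.eq_zero_iff_mem, hmk]
    exact (minpoly.irreducible hbint).separable.aeval_derivative_ne_zero (minpoly.aeval _ _)

theorem valuation_log_derivation_le_one [CharZero k]
    [Algebra (RatFunc k) E] [IsScalarTower k[X] (RatFunc k) E]
    [IsDedekindDomain (integralClosure k[X] E)]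
    [IsFractionRing (integralClosure k[X] E) E] [Module.Finite k[X] (integralClosure k[X] E)]
    (θ : Der E) (hC : ∀ c : k, θ (algebraMap k[X] E (C c)) = 0)
    (hX : θ (algebraMap k[X] E X) = -algebraMap k[X] E X)
    (v : HeightOneSpectrum (integralClosure k[X] E))
    (hπ : v.valuation E (algebraMap k[X] E X) < 1) {x : E} (hx : v.valuation E x ≤ 1) :
    v.valuation E (θ x) ≤ 1 := by
  have hnat : ∀ n : ℕ, n ≠ 0 → v.valuation E n = 1 := by
    intro n hn
    have := valuation_C v (c := (n : k)) (by exact_mod_cast hn)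
    rwa [map_natCast, map_natCast] at this
  have hpoly : ∀ p : k[X], v.valuation E (θ (algebraMap k[X] E p)) ≤ 1 := by
    intro p
    rw [derivation_algebraMap_polynomial θ hC, hX, ← map_neg, ← map_mul]
    exact valuation_algebraMap_le_one v _
  obtain ⟨G, hG⟩ := Module.Finite.fg_top (R := k[X]) (M := integralClosure k[X] E)
  have hspan : ∀ Γ : ℤᵐ⁰, (∀ g ∈ G, v.valuation E (θ g) ≤ max 1 Γ) →
      ∀ s : integralClosure k[X] E, v.valuation E (θ s) ≤ max 1 Γ := by
    intro Γ hΓ s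
    have hs : s ∈ Submodule.span k[X] (G : Set (integralClosure k[X] E)) := hG ▸ Submodule.mem_top
    induction hs using Submodule.span_induction with
    | mem g hg => exact hΓ g hg
    | zero => simp
    | add u w _ _ hu hw =>
      rw [Subalgebra.coe_add, map_add]
      exact (Valuation.map_add _ _ _).trans (max_le hu hw)
    | smul a u _ hu =>
      rw [Subalgebra.coe_smul, Algebra.smul_def, Derivation.leibniz, smul_eq_mul, smul_eq_mul]
      refine (Valuation.map_add _ _ _).trans (max_le ?_ ?_)
      · rw [map_mul]
        exact mul_le_of_le_one_of_le (valuation_algebraMap_le_one v a) hu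
      · rw [map_mul]
        exact (mul_le_one' (v.valuation_le_one u) (hpoly a)).trans (le_max_left _ _)
  by_cases hall : ∀ g ∈ G, v.valuation E (θ g) ≤ 1
  · refine valuation_derivation_le_one v θ _ (algebraMap_X_ne_zero (k := k)) hπ hX hnat 0
      (hspan 0 fun g hg => (hall g hg).trans (le_max_left _ _)) ⟨0, by simp, by simp⟩ hx
  · push Not at hall
    obtain ⟨g1, hg1, -⟩ := hall
    obtain ⟨g, hg, hmax⟩ := G.exists_max_image (fun g => v.valuation E (θ g)) ⟨g1, hg1⟩
    obtain ⟨p, hp, hp'⟩ := exists_residue_annihilator v hπ g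
    refine valuation_derivation_le_one v θ _ (algebraMap_X_ne_zero (k := k)) hπ hX hnat _
      (hspan _ fun g hg => (hmax g hg).trans (le_max_right _ _)) ⟨_, hp, ?_⟩ hx
    rw [derivation_eval₂ θ _ hC, map_mul, hp', one_mul]

end Nilpotence

section Nilpotence
open IsDedekindDomain WithZero

variable {k E : Type*} [Field k] [Field E] [Algebra k[X] E]

theorem exists_valuation_pow_mul_le_one
    [Algebra (RatFunc k) E] [IsScalarTower k[X] (RatFunc k) E] [FiniteDimensional (RatFunc k) E]
    [IsDedekindDomain (integralClosure k[X] E)] [IsFractionRing (integralClosure k[X] E) E]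
    (b : E) : ∃ M : ℕ, ∀ v : HeightOneSpectrum (integralClosure k[X] E),
      v.valuation E (algebraMap k[X] E X) < 1 →
      v.valuation E (algebraMap k[X] E X ^ M * b) ≤ 1 := by
  have halg : IsAlgebraic k[X] b :=
    (IsFractionRing.isAlgebraic_iff k[X] (RatFunc k) E).2 (Algebra.IsAlgebraic.isAlgebraic b)
  obtain ⟨a, ha, hab⟩ := halg.exists_integral_multiple
  obtain ⟨q, hq, hqX⟩ := exists_eq_pow_rootMultiplicity_mul_and_not_dvd a ha 0
  rw [C_0, sub_zero] at hq hqX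
  refine ⟨rootMultiplicity 0 a, fun v hv => ?_⟩
  have h1 : v.valuation E (algebraMap k[X] E q) = 1 := by
    have hc : q.coeff 0 ≠ 0 := fun h => hqX (X_dvd_iff.2 h)
    rw [← divX_mul_X_add q, map_add, map_mul, add_comm,
      Valuation.map_add_eq_of_lt_left, valuation_C v hc]
    rw [valuation_C v hc, map_mul]
    exact (mul_le_of_le_one_left' (valuation_algebraMap_le_one v _)).trans_lt hv
  have h2 : v.valuation E (a • b) ≤ 1 :=
    v.valuation_le_one (⟨a • b, hab⟩ : integralClosure k[X] E)
  rwa [hq, Algebra.smul_def, map_mul, map_mul, map_mul, h1, mul_one, ← map_mul, map_pow] at h2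

theorem valuation_iterate_derivation_le_one [CharZero k] [Algebra (RatFunc k) E]
    [IsScalarTower k[X] (RatFunc k) E]
    [IsDedekindDomain (integralClosure k[X] E)] [IsFractionRing (integralClosure k[X] E) E]
    [Module.Finite k[X] (integralClosure k[X] E)]
    (δ : Der E) (hC : ∀ c : k, δ (algebraMap k[X] E (C c)) = 0)
    (hX : δ (algebraMap k[X] E X) = -algebraMap k[X] E X ^ 2)
    (v : HeightOneSpectrum (integralClosure k[X] E))
    (hπ : v.valuation E (algebraMap k[X] E X) < 1) {b : E} {M : ℕ}
    (hb : v.valuation E (algebraMap k[X] E X ^ M * b) ≤ 1) (i : ℕ) :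
    v.valuation E (algebraMap k[X] E X ^ ((M : ℤ) - i) * δ^[i] b) ≤ 1 := by
  set π := algebraMap k[X] E X with hπdef
  have hπ0 : π ≠ 0 := algebraMap_X_ne_zero (k := k)
  let θ : Der E := π⁻¹ • δ
  have hθ : ∀ x, θ x = π⁻¹ * δ x := fun x => rfl
  induction i with
  | zero => simpa using hb
  | succ i ih =>
    rw [Function.iterate_succ_apply']
    set c := δ^[i] b
    have h1 := valuation_log_derivation_le_one θ (fun c => by rw [hθ, hC, mul_zero])
      (by rw [hθ, hX, ← hπdef]; field_simp) v hπ ih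
    have h2 : π ^ ((M : ℤ) - (i + 1 : ℕ)) * δ c =
        θ (π ^ ((M : ℤ) - i) * c) + algebraMap k[X] E (C (((M : ℤ) - i : ℤ) : k)) *
          (π ^ ((M : ℤ) - i) * c) := by
      have h3 : (M : ℤ) - i = (M - (i + 1 : ℕ) : ℤ) + 1 := by push_cast; ring
      rw [hθ, Derivation.leibniz, Derivation.leibniz_zpow, hX, map_intCast, map_intCast]
      simp only [smul_eq_mul, zsmul_eq_mul]
      rw [h3, add_sub_cancel_right, zpow_add_one₀ hπ0]
      field_simp
      ring
    rw [h2]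
    refine (Valuation.map_add _ _ _).trans (max_le h1 ?_)
    rw [map_mul]
    exact mul_le_one' (valuation_algebraMap_le_one v _) ih

theorem eq_zero_of_isIntegral_of_isIntegralElem [Algebra (RatFunc k) E]
    [IsScalarTower k[X] (RatFunc k) E] [FiniteDimensional (RatFunc k) E] {u : E}
    (hz : IsIntegral k[X] ((algebraMap k[X] E X)⁻¹ * u))
    (hu : (eval₂RingHom ((algebraMap k[X] E).comp C) (algebraMap k[X] E X)⁻¹).IsIntegralElem u) :
    u = 0 := by
  classical
  have hπ0 : algebraMap k[X] E X ≠ 0 := algebraMap_X_ne_zero (k := k)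
  obtain ⟨q, hq⟩ := IsIntegrallyClosed.isIntegral_iff.1 (Algebra.isIntegral_norm (RatFunc k) hz)
  have hN : Algebra.norm (RatFunc k) u =
      RatFunc.X ^ Module.finrank (RatFunc k) E * algebraMap k[X] (RatFunc k) q := by
    rw [hq, ← Algebra.norm_algebraMap (S := E), ← map_mul, ← RatFunc.algebraMap_X,
      ← IsScalarTower.algebraMap_apply, mul_inv_cancel_left₀ hπ0]
  let w := RatFunc.inftyValuation k
  have hw : ∀ p : k[X], w (eval₂RingHom (RatFunc.C (K := k)) (RatFunc.X)⁻¹ p) ≤ 1 := by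
    intro p
    have hc : ∀ c : k, w (RatFunc.C c) ≤ 1 := by
      intro c
      rcases eq_or_ne c 0 with rfl | hc
      · simp
      · exact (RatFunc.inftyValuation.C k hc).le
    have hX : w (RatFunc.X)⁻¹ ≤ 1 := by
      rw [map_inv₀, RatFunc.inftyValuation.X, ← exp_neg, ← exp_zero, exp_le_exp]
      norm_num
    induction p using Polynomial.induction_on' with
    | add p q hp hq =>
      rw [map_add]
      exact (Valuation.map_add _ _ _).trans (max_le hp hq)
    | monomial n r =>
      rw [coe_eval₂RingHom, eval₂_monomial, map_mul, map_pow]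
      exact mul_le_one' (hc r) (pow_le_one₀ zero_le hX)
  have hbint : IsIntegral w.integer (Algebra.norm (RatFunc k) u) := by
    apply Algebra.isIntegral_norm
    obtain ⟨p, hp, hpu⟩ := hu
    refine ⟨p.map ((eval₂RingHom (RatFunc.C (K := k)) (RatFunc.X)⁻¹).codRestrict w.integer hw),
      hp.map _, ?_⟩
    rw [eval₂_map, ← hpu]
    have h1 : ∀ r, algebraMap w.integer E ((eval₂RingHom (RatFunc.C (K := k))
        (RatFunc.X)⁻¹).codRestrict w.integer hw r) =
        algebraMap (RatFunc k) E (eval₂RingHom RatFunc.C (RatFunc.X)⁻¹ r) := fun _ => rfl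
    congr 1
    apply Polynomial.ringHom_ext
    · intro c
      rw [RingHom.comp_apply, h1]
      simp [IsScalarTower.algebraMap_apply k[X] (RatFunc k) E, RatFunc.algebraMap_C]
    · rw [RingHom.comp_apply, h1]
      simp [IsScalarTower.algebraMap_apply k[X] (RatFunc k) E, RatFunc.algebraMap_X]
  have hle : w (Algebra.norm (RatFunc k) u) ≤ 1 :=
    (Valuation.integer.integers w).mem_of_integral hbint
  have hq0 : q = 0 := by
    by_contra hq0
    rw [hN, map_mul, map_pow, RatFunc.inftyValuation.X, RatFunc.inftyValuation_apply,
      RatFunc.inftyValuation.polynomial k hq0, ← exp_nsmul, ← exp_add, ← exp_zero,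
      exp_le_exp] at hle
    have : 0 < Module.finrank (RatFunc k) E := Module.finrank_pos
    simp only [nsmul_eq_mul, mul_one] at hle
    omega
  rw [hq0, map_zero, mul_zero] at hN
  exact Algebra.norm_eq_zero_iff.1 hN

theorem iterate_derivation_eq_zero_of_isIntegralElem [CharZero k] [Algebra (RatFunc k) E]
    [IsScalarTower k[X] (RatFunc k) E] [FiniteDimensional (RatFunc k) E]
    (δ : Der E) (hC : ∀ c : k, δ (algebraMap k[X] E (C c)) = 0)
    (hX : δ (algebraMap k[X] E X) = -algebraMap k[X] E X ^ 2) (b : E)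
    (hb : ∀ i, (eval₂RingHom ((algebraMap k[X] E).comp C)
      (algebraMap k[X] E X)⁻¹).IsIntegralElem (δ^[i] b)) : ∃ N, δ^[N] b = 0 := by
  have : CharZero (RatFunc k) := charZero_of_injective_algebraMap (algebraMap k _).injective
  have : IsDedekindDomain (integralClosure k[X] E) :=
    integralClosure.isDedekindDomain k[X] (RatFunc k) E
  have : IsFractionRing (integralClosure k[X] E) E :=
    integralClosure.isFractionRing_of_finite_extension (RatFunc k) E
  have : Module.Finite k[X] (integralClosure k[X] E) :=
    IsIntegralClosure.finite k[X] (RatFunc k) E _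
  obtain ⟨M, hM⟩ := exists_valuation_pow_mul_le_one (k := k) b
  refine ⟨M + 1, eq_zero_of_isIntegral_of_isIntegralElem (k := k) ?_ (hb (M + 1))⟩
  have hle : ∀ v : HeightOneSpectrum (integralClosure k[X] E),
      v.valuation E ((algebraMap k[X] E X)⁻¹ * δ^[M + 1] b) ≤ 1 := by
    intro v
    rcases (valuation_algebraMap_le_one v X).lt_or_eq with hv | hv
    · have := valuation_iterate_derivation_le_one δ hC hX v hv (hM v hv) (M + 1)
      rwa [show (M : ℤ) - (M + 1 : ℕ) = -1 by push_cast; ring, zpow_neg_one] at this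
    · rw [map_mul, map_inv₀, hv, inv_one, one_mul]
      refine valuation_le_one_of_isIntegralElem _ _ (fun p => ?_) (hb (M + 1))
      induction p using Polynomial.induction_on' with
      | add p q hp hq =>
        rw [map_add]
        exact (Valuation.map_add _ _ _).trans (max_le hp hq)
      | monomial n r =>
        rw [coe_eval₂RingHom, eval₂_monomial, map_mul, map_pow, map_inv₀, hv, inv_one, one_pow,
          mul_one]
        exact valuation_algebraMap_le_one v (C r)
  obtain ⟨z, hz⟩ := HeightOneSpectrum.mem_integers_of_valuation_le_one
    (R := integralClosure k[X] E) E _ hle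
  rw [← hz]
  exact z.2

end Nilpotence

section DerivationAlgebraic

variable {R F : Type*} [Field R] [Field F] [Algebra R F]

theorem derivation_aeval_sub_mem (δ : Der F) (E : IntermediateField R F)
    (hE : ∀ r : R, δ (algebraMap R F r) ∈ E) {b : F} (hb : b ∈ E) (p : R[X]) :
    δ (aeval b p) - aeval b (derivative p) * δ b ∈ E := by
  induction p using Polynomial.induction_on' with
  | add p q hp hq =>
    convert E.add_mem hp hq using 1
    simp only [map_add]
    ring
  | monomial n r =>
    have : δ (aeval b (monomial n r)) - aeval b (derivative (monomial n r)) * δ b =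
        b ^ n * δ (algebraMap R F r) := by
      rw [derivative_monomial, aeval_monomial, aeval_monomial, Derivation.leibniz,
        Derivation.leibniz_pow]
      simp only [smul_eq_mul, nsmul_eq_mul, map_mul, map_natCast]
      ring
    rw [this]
    exact E.mul_mem (pow_mem hb n) (hE r)

theorem derivation_mem_of_isAlgebraic [CharZero R] (δ : Der F) (E : IntermediateField R F)
    (hE : ∀ r : R, δ (algebraMap R F r) ∈ E) {b : F} (hb : b ∈ E) (halg : IsAlgebraic R b) :
    δ b ∈ E := by
  have h := derivation_aeval_sub_mem δ E hE hb (minpoly R b)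
  rw [minpoly.aeval, map_zero, zero_sub, neg_mem_iff] at h
  have hne : aeval b (derivative (minpoly R b)) ≠ 0 :=
    (minpoly.irreducible halg.isIntegral).separable.aeval_derivative_ne_zero (minpoly.aeval _ _)
  have hmem : aeval b (derivative (minpoly R b)) ∈ E := by
    have := (aeval (⟨b, hb⟩ : E) (derivative (minpoly R b))).2
    rwa [← IntermediateField.aeval_coe] at this
  have := E.mul_mem (E.inv_mem hmem) h
  rwa [inv_mul_cancel_left₀ hne] at this

theorem derivation_eq_zero_of_isAlgebraic [CharZero R] (δ : Der F)
    (hR : ∀ r : R, δ (algebraMap R F r) = 0) {b : F} (halg : IsAlgebraic R b) : δ b = 0 := by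
  have h := derivation_eval₂ δ (algebraMap R F) hR b (minpoly R b)
  rw [← aeval_def, minpoly.aeval, map_zero, ← aeval_def] at h
  exact (mul_eq_zero.1 h.symm).resolve_left
    ((minpoly.irreducible halg.isIntegral).separable.aeval_derivative_ne_zero (minpoly.aeval _ _))

theorem derivation_mem_adjoin (δ : Der F) (S : Set F) (E : IntermediateField R F)
    (hS : IntermediateField.adjoin R S = E) (hE : ∀ r : R, δ (algebraMap R F r) ∈ E)
    (hSE : ∀ s ∈ S, δ s ∈ E) {b : F} (hb : b ∈ E) : δ b ∈ E := by
  subst hS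
  induction hb using IntermediateField.adjoin_induction with
  | mem s hs => exact hSE s hs
  | algebraMap r => exact hE r
  | add u w _ _ hu hw => rw [map_add]; exact add_mem hu hw
  | inv u hu hu' =>
    rw [Derivation.leibniz_inv, smul_eq_mul]
    exact mul_mem (neg_mem (pow_mem (inv_mem hu) 2)) hu'
  | mul u w hu hw hu₁ hw₁ =>
    rw [Derivation.leibniz, smul_eq_mul, smul_eq_mul]
    exact add_mem (mul_mem hu hw₁) (mul_mem hw hu₁)

/-- The restriction of a derivation to a stable intermediate field. -/
def Der.restrict (δ : Der F) (E : IntermediateField R F) (hE : ∀ b ∈ E, δ b ∈ E) : Der E :=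
  Derivation.mk' (AddMonoidHom.toIntLinearMap
    { toFun := fun b => ⟨δ b, hE b b.2⟩
      map_zero' := Subtype.ext (by simp)
      map_add' := fun a b => Subtype.ext (by simp) })
    (by
      intro a b
      apply Subtype.ext
      exact Derivation.leibniz δ (a : F) b)

theorem Der.coe_restrict (δ : Der F) (E : IntermediateField R F) (hE : ∀ b ∈ E, δ b ∈ E)
    (b : E) : (δ.restrict E hE b : F) = δ b := rfl

theorem Der.coe_iterate_restrict (δ : Der F) (E : IntermediateField R F) (hE : ∀ b ∈ E, δ b ∈ E)
    (b : E) (n : ℕ) : ((δ.restrict E hE)^[n] b : F) = δ^[n] b := by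
  induction n with
  | zero => rfl
  | succ n ih =>
    rw [Function.iterate_succ_apply', Function.iterate_succ_apply', Der.coe_restrict, ih]

end DerivationAlgebraic

section NilpotentOnField

variable {k F : Type*} [Field k] [Field F] [Algebra k F]

theorem aeval_toRingHom_eq_comp {T : Type*} [Field T] [Algebra k[X] T] (ι : T →+* F) {y : F}
    (hC : ∀ c : k, ι (algebraMap k[X] T (C c)) = algebraMap k F c)
    (hX : ι (algebraMap k[X] T X) = y⁻¹) :
    (aeval y : k[X] →ₐ[k] F).toRingHom = ι.comp
      (eval₂RingHom ((algebraMap k[X] T).comp C) (algebraMap k[X] T X)⁻¹) := by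
  apply Polynomial.ringHom_ext
  · intro c
    change aeval y (C c) = ι (eval₂RingHom _ _ _)
    rw [aeval_C, coe_eval₂RingHom, eval₂_C, RingHom.comp_apply, hC]
  · change aeval y X = ι (eval₂RingHom _ _ _)
    rw [aeval_X, coe_eval₂RingHom, eval₂_X, map_inv₀, hX, inv_inv]

theorem iterate_derivation_eq_zero_of_isIntegral [CharZero k] (δ : Der F)
    (hk : ∀ c : k, δ (algebraMap k F c) = 0) {y : F} (hy : δ y = 1) {b : F}
    (hb : ∀ i, (aeval y : k[X] →ₐ[k] F).toRingHom.IsIntegralElem (δ^[i] b)) :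
    ∃ N, δ^[N] b = 0 := by
  have hytr : Transcendental k y := fun halg =>
    one_ne_zero (hy.symm.trans (derivation_eq_zero_of_isAlgebraic δ hk halg))
  have hy0 : y ≠ 0 := by
    rintro rfl
    exact hytr (isAlgebraic_zero)
  have hitr : Transcendental k y⁻¹ := fun h => hytr (by simpa using h.inv)
  let f : k[X] →+* F := (aeval y⁻¹ : k[X] →ₐ[k] F).toRingHom
  have hf : Function.Injective f := transcendental_iff_injective.1 hitr
  let _ : Algebra k[X] F := f.toAlgebra
  let _ : Algebra (RatFunc k) F := (IsFractionRing.lift hf : RatFunc k →+* F).toAlgebra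
  have hfp : ∀ p : k[X], algebraMap k[X] F p = aeval y⁻¹ p := fun p => rfl
  have : IsScalarTower k[X] (RatFunc k) F := IsScalarTower.of_algebraMap_eq fun p =>
    (IsFractionRing.lift_algebraMap hf p).symm
  have hC : ∀ c : k, algebraMap k[X] F (C c) = algebraMap k F c := fun c => by rw [hfp, aeval_C]
  have hX : algebraMap k[X] F X = y⁻¹ := by rw [hfp, aeval_X]
  have hδX : δ y⁻¹ = -y⁻¹ ^ 2 := by
    rw [Derivation.leibniz_inv, hy, smul_eq_mul, mul_one]
  let E := IntermediateField.adjoin (RatFunc k) {b}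
  have hR : ∀ r : RatFunc k, ∃ r' : RatFunc k,
      δ (algebraMap (RatFunc k) F r) = algebraMap (RatFunc k) F r' := by
    have hp : ∀ p : k[X], δ (algebraMap k[X] F p) =
        algebraMap k[X] F (derivative p * -X ^ 2) := by
      intro p
      rw [derivation_algebraMap_polynomial δ (fun c => by rw [hC, hk]), hX, hδX, map_mul, map_neg,
        map_pow, hX]
    intro r
    obtain ⟨p, q, hq, rfl⟩ := IsFractionRing.div_surjective (A := k[X]) r
    refine ⟨algebraMap k[X] (RatFunc k) (q * (derivative p * -X ^ 2) -
      p * (derivative q * -X ^ 2)) / algebraMap k[X] (RatFunc k) q ^ 2, ?_⟩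
    simp only [map_div₀, map_pow, ← IsScalarTower.algebraMap_apply]
    rw [Derivation.leibniz_div, hp, hp]
    simp only [smul_eq_mul, map_sub, map_mul]
    ring
  have hbE : b ∈ E := IntermediateField.mem_adjoin_simple_self _ b
  have hRE : ∀ r : RatFunc k, δ (algebraMap (RatFunc k) F r) ∈ E := by
    intro r
    obtain ⟨r', hr'⟩ := hR r
    rw [hr']
    exact E.algebraMap_mem r'
  have halg : IsAlgebraic (RatFunc k) b := by
    obtain ⟨p, hp, hpb⟩ := hb 0
    rw [aeval_toRingHom_eq_comp (algebraMap (RatFunc k) F)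
      (fun c => by rw [← IsScalarTower.algebraMap_apply, hC])
      (by rw [← IsScalarTower.algebraMap_apply, hX])] at hpb
    exact IsIntegral.isAlgebraic ⟨_, hp.map _, (eval₂_map _ _ _).trans hpb⟩
  have hEst : ∀ x ∈ E, δ x ∈ E := fun x hx =>
    derivation_mem_adjoin δ {b} E rfl hRE (by
      rintro _ rfl
      exact derivation_mem_of_isAlgebraic δ E hRE hbE halg) hx
  have : FiniteDimensional (RatFunc k) E :=
    IntermediateField.adjoin.finiteDimensional halg.isIntegral
  let _ : Algebra k[X] E :=
    ((algebraMap (RatFunc k) E).comp (algebraMap k[X] (RatFunc k))).toAlgebra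
  have : IsScalarTower k[X] (RatFunc k) E := IsScalarTower.of_algebraMap_eq fun p => rfl
  have hcoe : ∀ p : k[X], E.val (algebraMap k[X] E p) = algebraMap k[X] F p := fun p =>
    (IsScalarTower.algebraMap_apply k[X] (RatFunc k) F p).symm
  obtain ⟨N, hN⟩ := iterate_derivation_eq_zero_of_isIntegralElem (k := k) (δ.restrict E hEst)
    (fun c => Subtype.ext (by
      refine (congrArg δ (hcoe _)).trans ?_
      rw [hC, hk]
      rfl))
    (Subtype.ext (by
      refine (congrArg δ (hcoe _)).trans ?_
      rw [hX, hδX, ← hX, ← hcoe]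
      rfl)) ⟨b, hbE⟩ (fun i => by
      obtain ⟨p, hp, hpb⟩ := hb i
      refine ⟨p, hp, Subtype.ext ?_⟩
      rw [aeval_toRingHom_eq_comp E.val.toRingHom (fun c => (hcoe _).trans (hC c))
        ((hcoe _).trans hX), ← Der.coe_iterate_restrict δ E hEst ⟨b, hbE⟩] at hpb
      exact (hom_eval₂ p _ E.val.toRingHom _).trans hpb)
  exact ⟨N, by rw [← Der.coe_iterate_restrict δ E hEst ⟨b, hbE⟩, hN]; rfl⟩

end NilpotentOnField

section DerFinite

variable {K F : Type*} [Field K] [Field F] [Algebra K F]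

/-- Elements lying in a finitely generated `A`-submodule stable under the derivation. -/
def DerFinite (A : Subalgebra K F) (δ : Der F) (b : F) : Prop :=
  ∃ G : Finset F, (∀ g ∈ G, δ g ∈ Submodule.span A (G : Set F)) ∧ b ∈ Submodule.span A (G : Set F)

namespace DerFinite

variable {A : Subalgebra K F} {δ : Der F} {a b : F}

theorem mem (ha : a ∈ A) : DerFinite A δ a := by
  refine ⟨{1}, by simp, ?_⟩
  have := Submodule.smul_mem (Submodule.span A (({1} : Finset F) : Set F)) (⟨a, ha⟩ : A)
    (Submodule.subset_span (by simp : (1 : F) ∈ (({1} : Finset F) : Set F)))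
  simpa [Subalgebra.smul_def] using this

theorem mul_left (ha : a ∈ A) (hb : DerFinite A δ b) : DerFinite A δ (a * b) := by
  obtain ⟨G, hG, hb⟩ := hb
  exact ⟨G, hG, Submodule.smul_mem _ (⟨a, ha⟩ : A) hb⟩

theorem sub (ha : DerFinite A δ a) (hb : DerFinite A δ b) : DerFinite A δ (a - b) := by
  classical
  obtain ⟨G, hG, ha⟩ := ha
  obtain ⟨H, hH, hb⟩ := hb
  have h1 : Submodule.span A (G : Set F) ≤ Submodule.span A ((G ∪ H : Finset F) : Set F) :=
    Submodule.span_mono (by simp)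
  have h2 : Submodule.span A (H : Set F) ≤ Submodule.span A ((G ∪ H : Finset F) : Set F) :=
    Submodule.span_mono (by simp)
  refine ⟨G ∪ H, fun g hg => ?_, Submodule.sub_mem _ (h1 ha) (h2 hb)⟩
  rcases Finset.mem_union.1 hg with hg | hg
  · exact h1 (hG g hg)
  · exact h2 (hH g hg)

/-- A pair of derivations normalising `δ` modulo each other preserves the class. -/
theorem derivation {p q : Der F} (hp : ∀ a ∈ A, p a ∈ A) (hq : ∀ a ∈ A, q a ∈ A)
    {α β γ ε : F} (hα : α ∈ A) (hβ : β ∈ A) (hγ : γ ∈ A) (hε : ε ∈ A)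
    (hδp : ∀ b, δ (p b) = p (δ b) - (α * p b + β * q b))
    (hδq : ∀ b, δ (q b) = q (δ b) - (γ * p b + ε * q b))
    (hb : DerFinite A δ b) : DerFinite A δ (p b) ∧ DerFinite A δ (q b) := by
  classical
  obtain ⟨G, hG, hb⟩ := hb
  let H : Finset F := G ∪ G.image p ∪ G.image q
  let N := Submodule.span A (H : Set F)
  have hGN : (G : Set F) ⊆ N := fun g hg => Submodule.subset_span (by
    simp only [H, Finset.coe_union]; exact Or.inl (Or.inl hg))
  have hpN : ∀ g ∈ (G : Set F), p g ∈ N := fun g hg => Submodule.subset_span (by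
    simp only [H, Finset.coe_union, Finset.coe_image]; exact Or.inl (Or.inr ⟨g, hg, rfl⟩))
  have hqN : ∀ g ∈ (G : Set F), q g ∈ N := fun g hg => Submodule.subset_span (by
    simp only [H, Finset.coe_union, Finset.coe_image]; exact Or.inr ⟨g, hg, rfl⟩)
  have hps : ∀ {b}, b ∈ Submodule.span A (G : Set F) → p b ∈ N := fun hb =>
    derivation_mem_span A p hp hGN hpN hb
  have hqs : ∀ {b}, b ∈ Submodule.span A (G : Set F) → q b ∈ N := fun hb =>
    derivation_mem_span A q hq hGN hqN hb
  have hsm : ∀ {a b}, a ∈ A → b ∈ N → a * b ∈ N := fun {a b} ha hb =>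
    Submodule.smul_mem N (⟨a, ha⟩ : A) hb
  have hH : ∀ g ∈ H, δ g ∈ N := by
    intro g hg
    rcases Finset.mem_union.1 hg with hg | hg
    · rcases Finset.mem_union.1 hg with hg | hg
      · exact Submodule.span_le.2 hGN (hG g hg)
      · obtain ⟨g, hg', rfl⟩ := Finset.mem_image.1 hg
        rw [hδp]
        exact N.sub_mem (hps (hG g hg')) (N.add_mem (hsm hα (hpN g hg')) (hsm hβ (hqN g hg')))
    · obtain ⟨g, hg', rfl⟩ := Finset.mem_image.1 hg
      rw [hδq]
      exact N.sub_mem (hqs (hG g hg')) (N.add_mem (hsm hγ (hpN g hg')) (hsm hε (hqN g hg')))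
  exact ⟨⟨H, hH, hps hb⟩, ⟨H, hH, hqs hb⟩⟩

end DerFinite

theorem iterate_derivation_pow_mul (D : Der F) {y : F} (hy : D y = 1) (n : ℕ) :
    ∀ e, D e = 0 → D^[n] (y ^ n * e) = (n.factorial : F) * e := by
  induction n with
  | zero => simp
  | succ n ih =>
    intro e he
    have h1 : D (y ^ (n + 1) * e) = y ^ n * ((n + 1 : ℕ) * e) := by
      rw [Derivation.leibniz, Derivation.leibniz_pow, he, hy]
      simp only [smul_eq_mul, nsmul_eq_mul, Nat.add_sub_cancel]
      ring
    rw [Function.iterate_succ_apply, h1, ih _ (by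
      rw [Derivation.leibniz, he, Derivation.map_natCast]; simp), Nat.factorial_succ]
    push_cast
    ring

/-- Taylor expansion along a locally nilpotent derivation with a slice. -/
theorem mem_of_iterate_derivation_eq_zero [CharZero K] {A : Subalgebra K F} {δ : Der F} (D : Der F)
    {y : F} (hyA : y ∈ A) (hy : D y = 1) (hD : ∀ b, DerFinite A δ b → DerFinite A δ (D b))
    (C : Set F) (hC : ∀ b ∈ C, D b ∈ C) (hCm : ∀ b ∈ C, ∀ e ∈ C, ∀ n : ℕ, ∀ r : K,
      b - algebraMap K F r * (y ^ n * e) ∈ C)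
    (hbase : ∀ e ∈ C, DerFinite A δ e → D e = 0 → e ∈ A) (N : ℕ) :
    ∀ b ∈ C, DerFinite A δ b → D^[N] b = 0 → b ∈ A := by
  have : CharZero F := charZero_of_injective_algebraMap (algebraMap K F).injective
  induction N with
  | zero =>
    intro b _ _ hb
    rw [Function.iterate_zero_apply] at hb
    rw [hb]
    exact A.zero_mem
  | succ N ih =>
    intro b hbC hb hN
    have hiter : ∀ n, D^[n] b ∈ C ∧ DerFinite A δ (D^[n] b) := by
      intro n
      induction n with
      | zero => exact ⟨hbC, hb⟩
      | succ n ih =>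
        rw [Function.iterate_succ_apply']
        exact ⟨hC _ ih.1, hD _ ih.2⟩
    set e := D^[N] b with he
    have hDe : D e = 0 := (Function.iterate_succ_apply' D N b).symm.trans hN
    have heA : e ∈ A := hbase e (hiter N).1 (hiter N).2 hDe
    set w := algebraMap K F (N.factorial : K)⁻¹ * (y ^ N * e) with hw
    have hwA : w ∈ A := A.mul_mem (A.algebraMap_mem _) (A.mul_mem (A.pow_mem hyA N) heA)
    have hwD : D^[N] w = e := by
      have h0 : (N.factorial : F) ≠ 0 := by exact_mod_cast N.factorial_ne_zero
      have h1 : w = y ^ N * ((N.factorial : F)⁻¹ * e) := by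
        rw [hw, map_inv₀, map_natCast]; ring
      rw [h1, iterate_derivation_pow_mul D hy]
      · field_simp
      · rw [Derivation.leibniz, hDe, Derivation.leibniz_inv, Derivation.map_natCast]; simp
    have h2 : b - w ∈ A := by
      refine ih _ (hCm b hbC e (hiter N).1 N _) (hb.sub (DerFinite.mem hwA)) ?_
      rw [iterate_map_sub, hwD, sub_self]
    have := A.add_mem h2 hwA
    rwa [sub_add_cancel] at this

theorem isIntegralElem_of_le_range {R : Type*} [CommRing R] {A : Subalgebra K F} (f : R →+* F)
    (hAf : ∀ a ∈ A, a ∈ f.range) {z : F} (hz : IsIntegral A z) : f.IsIntegralElem z := by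
  obtain ⟨p, hp, hpz⟩ := hz
  let ι : A →+* f.range := A.val.toRingHom.codRestrict f.range fun a => hAf a a.2
  have hl : p.map ι ∈ lifts f.rangeRestrict := by
    rw [lifts_iff_coeff_lifts]
    intro n
    exact f.rangeRestrict_surjective _
  obtain ⟨q, hq, -, hqm⟩ := lifts_and_natDegree_eq_and_monic hl (hp.map ι)
  refine ⟨q, hqm, ?_⟩
  have h1 : eval₂ (f.range.subtype.comp f.rangeRestrict) z q = 0 := by
    rw [← eval₂_map, hq, eval₂_map]
    exact hpz
  exact h1

/-- The field of constants of a derivation. -/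
def Der.ker (δ : Der F) : Subfield F where
  carrier := {b | δ b = 0}
  mul_mem' {a b} ha hb := by
    rw [Set.mem_ofPred_eq] at *
    rw [Derivation.leibniz, ha, hb]
    simp
  one_mem' := by simp
  add_mem' {a b} ha hb := by
    rw [Set.mem_ofPred_eq] at *
    rw [map_add, ha, hb, add_zero]
  zero_mem' := by simp
  neg_mem' {a} ha := by
    rw [Set.mem_ofPred_eq] at *
    rw [map_neg, ha, neg_zero]
  inv_mem' a ha := by
    rw [Set.mem_ofPred_eq] at *
    rw [Derivation.leibniz_inv, ha, smul_zero]

theorem Der.mem_ker {δ : Der F} {b : F} : b ∈ δ.ker ↔ δ b = 0 := Iff.rfl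

variable [CharZero K]

theorem DerFinite.mem_range_of_dual {x y : F} {δ : Der F} (Δ : Der K[X][X])
    (hcompat : ∀ p, δ (aevalAeval (R := K) x y p) = aevalAeval (R := K) x y (Δ p))
    (hΔ : ∀ f : K[X][X], f ≠ 0 → f ∣ Δ f → ∃ r, f = C (C r))
    (halg : Algebra.IsAlgebraic (aevalAeval (R := K) x y).range F) {dy dx : Der F}
    (hyK : ∀ r : K, dy (algebraMap K F r) = 0) (hxK : ∀ r : K, dx (algebraMap K F r) = 0)
    (hyy : dy y = 1) (hyx : dy x = 0) (hxy : dx y = 0) (hxx : dx x = 1)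
    (hcomm : ∀ b, dx (dy b) = dy (dx b))
    (hker : ∀ b, dy b = 0 → dx b = 0 → b ∈ (algebraMap K F).range)
    {α β γ ε : K[X][X]}
    (hδy : ∀ b, δ (dy b) = dy (δ b) -
      (aevalAeval (R := K) x y α * dy b + aevalAeval (R := K) x y β * dx b))
    (hδx : ∀ b, δ (dx b) = dx (δ b) -
      (aevalAeval (R := K) x y γ * dy b + aevalAeval (R := K) x y ε * dx b))
    {b : F} (hb : DerFinite (aevalAeval (R := K) x y).range δ b) :
    b ∈ (aevalAeval (R := K) x y).range := by
  set A := (aevalAeval (R := K) x y).range with hA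
  have hxA : x ∈ A := ⟨C X, aevalAeval_inner x y⟩
  have hyA : y ∈ A := ⟨X, aevalAeval_outer x y⟩
  have hstab : ∀ {D : Der F}, (∀ r : K, D (algebraMap K F r) = 0) → D y ∈ A → D x ∈ A →
      ∀ a ∈ A, D a ∈ A := by
    rintro D hD hy hx _ ⟨p, rfl⟩
    change D (aevalAeval (R := K) x y p) ∈ A
    rw [derivation_aevalAeval (0 : Der K) D (by simpa using hD)]
    exact A.add_mem (A.add_mem ⟨_, rfl⟩ (A.mul_mem ⟨_, rfl⟩ hy)) (A.mul_mem ⟨_, rfl⟩ hx)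
  have hyst := hstab hyK (hyy ▸ A.one_mem) (hyx ▸ A.zero_mem)
  have hxst := hstab hxK (hxy ▸ A.zero_mem) (hxx ▸ A.one_mem)
  have hcl : ∀ {b}, DerFinite A δ b → DerFinite A δ (dy b) ∧ DerFinite A δ (dx b) := fun hb =>
    hb.derivation hyst hxst ⟨α, rfl⟩ ⟨β, rfl⟩ ⟨γ, rfl⟩ ⟨ε, rfl⟩ hδy hδx
  have htr : ∀ {D : Der F} {z : F}, (∀ r : K, D (algebraMap K F r) = 0) → D z = 1 →
      ∀ h : K[X], h ≠ 0 → aeval z h ≠ 0 := by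
    intro D z hD hz h h0 hh
    exact one_ne_zero (hz.symm.trans (derivation_eq_zero_of_isAlgebraic D hD ⟨h, h0, hh⟩))
  have hnil : ∀ {D : Der F} {z w : F} (_ : ∀ r : K, D (algebraMap K F r) = 0) (_ : D z = 1)
      (_ : D w = 0) (_ : x = z ∨ x = w) (_ : y = z ∨ y = w)
      (b : F) (_ : ∀ i, ∃ h : K[X], aeval w h ≠ 0 ∧ IsIntegral A (aeval w h * D^[i] b)),
      ∃ N, D^[N] b = 0 := by
    intro D z w hDK hDz hDw hx hy b hbint
    have : CharZero F := charZero_of_injective_algebraMap (algebraMap K F).injective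
    have hrange : ∀ u : F, D u = 0 → ∃ c : D.ker[X], aeval z c = u := fun u hu =>
      ⟨C ⟨u, hu⟩, aeval_C _ _⟩
    have hzw : ∀ u, u = z ∨ u = w → ∃ c : D.ker[X], aeval z c = u := by
      rintro u (rfl | rfl)
      · exact ⟨X, aeval_X _⟩
      · exact hrange _ hDw
    refine iterate_derivation_eq_zero_of_isIntegral (k := D.ker) D (fun c => c.2) hDz fun i => ?_
    obtain ⟨h, h0, hi⟩ := hbint i
    have hDh : D (aeval w h) = 0 := by
      rw [aeval_def, derivation_eval₂ D _ hDK, hDw, mul_zero]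
    have hinv : D (aeval w h)⁻¹ = 0 := by rw [Derivation.leibniz_inv, hDh, smul_zero]
    have hmem : ∀ a ∈ A, a ∈ (aeval z : D.ker[X] →ₐ[D.ker] F).toRingHom.range := by
      rintro _ ⟨p, rfl⟩
      change aevalAeval (R := K) x y p ∈ _
      induction p using bivariate_induction with
      | hadd p q hp hq => rw [map_add]; exact add_mem hp hq
      | hmul p q hp hq => rw [map_mul]; exact mul_mem hp hq
      | hC r => rw [aevalAeval_CC]; exact hrange _ (hDK r)
      | hCX => rw [aevalAeval_inner]; exact hzw _ hx
      | hX => rw [aevalAeval_outer]; exact hzw _ hy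
    have h1 := isIntegralElem_of_le_range _ hmem hi
    obtain ⟨c, hc⟩ := hrange _ hinv
    have h2 := RingHom.IsIntegralElem.mul _
      ((aeval z : D.ker[X] →ₐ[D.ker] F).toRingHom.isIntegralElem_map (x := c)) h1
    have h3 : (aeval z : D.ker[X] →ₐ[D.ker] F).toRingHom c = (aeval w h)⁻¹ := hc
    rwa [h3, inv_mul_cancel_left₀ h0] at h2
  have hyn : ∀ {b}, DerFinite A δ b → ∃ N, dy^[N] b = 0 := by
    intro b hb
    have hbi : ∀ i, DerFinite A δ (dy^[i] b) := by
      intro i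
      induction i with
      | zero => exact hb
      | succ n ih => rw [Function.iterate_succ_apply']; exact (hcl ih).1
    refine hnil hyK hyy hyx (Or.inr rfl) (Or.inl rfl) b fun i => ?_
    obtain ⟨G, hG, hbG⟩ := hbi i
    obtain ⟨⟨h, h0, hi⟩, -⟩ := exists_isIntegral_of_mem_span x y δ Δ hcompat hΔ halg G hG _ hbG
    exact ⟨h, htr hxK hxx h h0, hi⟩
  have hxn : ∀ {b}, DerFinite A δ b → ∃ N, dx^[N] b = 0 := by
    intro b hb
    have hbi : ∀ i, DerFinite A δ (dx^[i] b) := by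
      intro i
      induction i with
      | zero => exact hb
      | succ n ih => rw [Function.iterate_succ_apply']; exact (hcl ih).2
    refine hnil hxK hxx hxy (Or.inl rfl) (Or.inr rfl) b fun i => ?_
    obtain ⟨G, hG, hbG⟩ := hbi i
    obtain ⟨-, ⟨h, h0, hi⟩⟩ := exists_isIntegral_of_mem_span x y δ Δ hcompat hΔ halg G hG _ hbG
    exact ⟨h, htr hyK hyy h h0, hi⟩
  have hstep : ∀ e, DerFinite A δ e → dy e = 0 → e ∈ A := by
    intro e he hye
    obtain ⟨N, hN⟩ := hxn he
    refine mem_of_iterate_derivation_eq_zero dx hxA hxx (fun b hb => (hcl hb).2) {b | dy b = 0}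
      (fun b hb => ?_) (fun b hb e he n r => ?_) (fun e hey _ hex => ?_) N e hye he hN
    · change dy (dx b) = 0
      rw [← hcomm, show dy b = 0 from hb, map_zero]
    · change dy _ = 0
      rw [map_sub, Derivation.leibniz, Derivation.leibniz, Derivation.leibniz_pow,
        show dy b = 0 from hb, show dy e = 0 from he, hyx, hyK]
      simp
    · obtain ⟨r, rfl⟩ := hker e hey hex
      exact A.algebraMap_mem r
  obtain ⟨N, hN⟩ := hyn hb
  exact mem_of_iterate_derivation_eq_zero dy hyA hyy (fun b hb => (hcl hb).1) Set.univ
    (fun b _ => trivial) (fun b _ e _ n r => trivial) (fun e _ => hstep e) N b trivial hb hN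

end DerFinite

section ExistsDerivation
open KaehlerDifferential

theorem IsAlgebraic.mono_subset {F σ τ : Type*} [Field F] [SetLike σ F] [SubringClass σ F]
    [SetLike τ F] [SubringClass τ F] {A : σ} {b : F} (hb : IsAlgebraic A b) (B : τ)
    (h : ∀ a ∈ A, a ∈ B) : IsAlgebraic B b :=
  hb.ringHom_of_comp_eq ((SubringClass.subtype A).codRestrict B fun a => h a a.2) (RingHom.id F)
    (fun _ _ hab => Subtype.ext (congrArg (fun z : B => (z : F)) hab)) rfl

theorem IsTranscendenceBasis.exists_derivation {ι K F : Type*} [Field K] [CharZero K] [Field F]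
    [Algebra K F] {s : ι → F} (hs : IsTranscendenceBasis K s) (v : ι → F) :
    ∃ D : Derivation K F F, ∀ i, D (s i) = v i := by
  let f : MvPolynomial ι K →ₐ[K] F := MvPolynomial.aeval s
  let _ : Algebra (MvPolynomial ι K) F := f.toRingHom.toAlgebra
  have hf : ∀ p, algebraMap (MvPolynomial ι K) F p = MvPolynomial.aeval s p := fun p => rfl
  have : IsScalarTower K (MvPolynomial ι K) F := IsScalarTower.of_algebraMap_eq fun r => by
    rw [hf, MvPolynomial.algebraMap_eq, MvPolynomial.aeval_C]
  have : FaithfulSMul (MvPolynomial ι K) F := (faithfulSMul_iff_algebraMap_injective _ _).2 hs.1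
  let Q := FractionRing (MvPolynomial ι K)
  let _ : Algebra Q F := FractionRing.liftAlgebra (MvPolynomial ι K) F
  have : IsScalarTower (MvPolynomial ι K) Q F := inferInstance
  have halg : Algebra.IsAlgebraic (MvPolynomial ι K) F := by
    have h1 := hs.isAlgebraic
    refine ⟨fun a => ?_⟩
    have h2 : Set.range s ⊆ f.range := by
      rintro _ ⟨i, rfl⟩
      exact ⟨MvPolynomial.X i, MvPolynomial.aeval_X s i⟩
    have h3 := (h1.isAlgebraic a).mono_subset f.range
      fun b hb => Algebra.adjoin_le (S := f.range) h2 hb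
    exact h3.of_ringHom_of_comp_eq f.rangeRestrict.toRingHom (RingHom.id F)
      f.rangeRestrict_surjective Function.injective_id rfl
  have : Algebra.IsAlgebraic Q F :=
    (IsFractionRing.comap_isAlgebraic_iff (A := MvPolynomial ι K) (K := Q) (C := F)).1 halg
  have : CharZero Q := charZero_of_injective_algebraMap
    (FaithfulSMul.algebraMap_injective (MvPolynomial ι K) Q)
  have : Algebra.FormallyEtale (MvPolynomial ι K) Q :=
    Algebra.FormallyEtale.of_isLocalization (nonZeroDivisors _)
  have : Algebra.FormallyEtale Q F := Algebra.FormallyEtale.of_isSeparable _ _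
  have : Algebra.FormallyEtale (MvPolynomial ι K) F :=
    Algebra.FormallyEtale.comp (MvPolynomial ι K) Q F
  let d : Derivation K (MvPolynomial ι K) F := MvPolynomial.mkDerivation K v
  let l : Ω[F⁄K] →ₗ[F] F := (d.liftKaehlerDifferential.liftBaseChange F) ∘ₗ
    (tensorKaehlerEquivOfFormallyEtale K (MvPolynomial ι K) F).symm.toLinearMap
  refine ⟨l.compDer (KaehlerDifferential.D K F), fun i => ?_⟩
  have h1 := tensorKaehlerEquivOfFormallyEtale_symm_D_algebraMap K (MvPolynomial ι K) F
    (MvPolynomial.X i)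
  rw [hf, MvPolynomial.aeval_X] at h1
  change d.liftKaehlerDifferential.liftBaseChange F
    ((tensorKaehlerEquivOfFormallyEtale K (MvPolynomial ι K) F).symm (D K F (s i))) = _
  rw [h1]
  simp [d]

theorem IsTranscendenceBasis.exists_der {K F : Type*} [Field K] [CharZero K] [Field F]
    [Algebra K F] {s : Fin 4 → F} (hs : IsTranscendenceBasis K s) (v : Fin 4 → F) :
    ∃ D : Der F, (∀ r, D (algebraMap K F r) = 0) ∧ ∀ i, D (s i) = v i := by
  obtain ⟨D, hD⟩ := hs.exists_derivation v
  exact ⟨D.restrictScalars ℤ, fun r => D.map_algebraMap r, hD⟩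

theorem IsTranscendenceBasis.der_eq_zero {ι K F : Type*} [Field K] [CharZero K] [Field F]
    [Algebra K F] {s : ι → F} (hs : IsTranscendenceBasis K s) {D : Der F}
    (hK : ∀ r, D (algebraMap K F r) = 0) (h0 : ∀ i, D (s i) = 0) (b : F) : D b = 0 := by
  have : CharZero F := charZero_of_injective_algebraMap (algebraMap K F).injective
  refine derivation_eq_zero_of_isAlgebraic (R := D.ker) D (fun r => r.2)
    ((hs.isAlgebraic.isAlgebraic b).mono_subset D.ker fun a ha => ?_)
  induction ha using Algebra.adjoin_induction with
  | mem x hx => obtain ⟨i, rfl⟩ := hx; exact h0 i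
  | algebraMap r => exact hK r
  | add x y _ _ hx hy => exact add_mem hx hy
  | mul x y _ _ hx hy => exact mul_mem hx hy

end ExistsDerivation

section ThreeSolutions

/-- Solutions of the third Painlevé system for a derivation `δ` with `δ t = t`. -/
def IsPVSolution {F : Type*} [CommRing F] (δ : Der F) (t a c y x : F) : Prop :=
  δ y = 2 * y ^ 2 * x - y ^ 2 + a * y + t ∧ δ x = -(2 * y * x ^ 2) + 2 * y * x - a * x + c

theorem IsPVSolution.variational {F : Type*} [CommRing F] {δ : Der F} {t a c y x : F}
    (h : IsPVSolution δ t a c y x) {θ : Der F} (ht : θ t = 0) (ha : θ a = 0) (hc : θ c = 0) :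
    θ (δ y) = (4 * x * y - 2 * y + a) * θ y + 2 * y ^ 2 * θ x ∧
      θ (δ x) = (2 * x - 2 * x ^ 2) * θ y - (4 * x * y - 2 * y + a) * θ x := by
  rw [h.1, h.2]
  constructor <;>
  · simp only [map_add, map_sub, map_neg, Derivation.leibniz, Derivation.leibniz_pow, smul_eq_mul,
      ht, ha, hc, Der.map_two, nsmul_eq_mul]
    push_cast
    ring

variable {K F : Type*} [Field K] [Field F] [Algebra K F]

theorem aevalAeval_jacobian (x y : F) (a : K) :
    aevalAeval (R := K) x y (4 * X * C X - 2 * X + C (C a)) =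
        4 * x * y - 2 * y + algebraMap K F a ∧
      aevalAeval (R := K) x y (2 * C X - 2 * C X ^ 2) = 2 * x - 2 * x ^ 2 ∧
      aevalAeval (R := K) x y (2 * X ^ 2) = 2 * y ^ 2 := by
  refine ⟨?_, ?_, ?_⟩
  · simp only [map_add, map_sub, map_mul, map_ofNat, aevalAeval_outer, aevalAeval_inner,
      aevalAeval_CC]
    ring
  · simp only [map_sub, map_mul, map_ofNat, map_pow, aevalAeval_inner]
  · simp only [map_mul, map_ofNat, map_pow, aevalAeval_outer]

variable [CharZero K]

theorem exists_dual_derivations {δ : Der F} {d : Der K}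
    (hd : ∀ r, δ (algebraMap K F r) = algebraMap K F (d r)) {t a c : K} {y₁ x₁ y₂ x₂ : F}
    (h₁ : IsPVSolution δ (algebraMap K F t) (algebraMap K F a) (algebraMap K F c) y₁ x₁)
    (h₂ : IsPVSolution δ (algebraMap K F t) (algebraMap K F a) (algebraMap K F c) y₂ x₂)
    (hs : IsTranscendenceBasis K ![y₁, x₁, y₂, x₂]) :
    ∃ θy θx : Der F, (∀ r, θy (algebraMap K F r) = 0) ∧ (∀ r, θx (algebraMap K F r) = 0) ∧
      (θy y₁ = 0 ∧ θy x₁ = 0 ∧ θx y₁ = 0 ∧ θx x₁ = 0) ∧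
      (θy y₂ = 1 ∧ θy x₂ = 0 ∧ θx y₂ = 0 ∧ θx x₂ = 1) ∧
      (∀ b, θx (θy b) = θy (θx b)) ∧
      (∀ b, δ (θy b) = θy (δ b) -
        ((4 * x₂ * y₂ - 2 * y₂ + algebraMap K F a) * θy b + (2 * x₂ - 2 * x₂ ^ 2) * θx b)) ∧
      (∀ b, δ (θx b) = θx (δ b) -
        (2 * y₂ ^ 2 * θy b + -(4 * x₂ * y₂ - 2 * y₂ + algebraMap K F a) * θx b)) := by
  obtain ⟨θy, hyK, hy⟩ := hs.exists_der ![0, 0, 1, 0]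
  obtain ⟨θx, hxK, hx⟩ := hs.exists_der ![0, 0, 0, 1]
  have hy1 : θy y₁ = 0 := hy 0
  have hy2 : θy x₁ = 0 := hy 1
  have hy3 : θy y₂ = 1 := hy 2
  have hy4 : θy x₂ = 0 := hy 3
  have hx1 : θx y₁ = 0 := hx 0
  have hx2 : θx x₁ = 0 := hx 1
  have hx3 : θx y₂ = 0 := hx 2
  have hx4 : θx x₂ = 1 := hx 3
  have vy1 := h₁.variational (hyK t) (hyK a) (hyK c)
  have vy2 := h₂.variational (hyK t) (hyK a) (hyK c)
  have vx1 := h₁.variational (hxK t) (hxK a) (hxK c)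
  have vx2 := h₂.variational (hxK t) (hxK a) (hxK c)
  refine ⟨θy, θx, hyK, hxK, ⟨hy1, hy2, hx1, hx2⟩, ⟨hy3, hy4, hx3, hx4⟩, fun b => ?_, fun b => ?_,
    fun b => ?_⟩
  · have := hs.der_eq_zero (D := ⁅θx, θy⁆)
      (fun r => by rw [Derivation.commutator_apply, hyK, hxK, map_zero, map_zero, sub_zero])
      (fun i => by
        fin_cases i
        · change ⁅θx, θy⁆ y₁ = 0
          simp [Derivation.commutator_apply, *]
        · change ⁅θx, θy⁆ x₁ = 0
          simp [Derivation.commutator_apply, *]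
        · change ⁅θx, θy⁆ y₂ = 0
          simp [Derivation.commutator_apply, *]
        · change ⁅θx, θy⁆ x₂ = 0
          simp [Derivation.commutator_apply, *]) b
    rwa [Derivation.commutator_apply, sub_eq_zero] at this
  · have h := hs.der_eq_zero (D := ⁅δ, θy⁆ +
        (4 * x₂ * y₂ - 2 * y₂ + algebraMap K F a) • θy + (2 * x₂ - 2 * x₂ ^ 2) • θx)
      (fun r => by
        simp only [Derivation.add_apply, Derivation.smul_apply, Derivation.commutator_apply, hyK,
          hxK, hd, map_zero]
        simp)
      (fun i => by
        fin_cases i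
        · change (_ : Der F) y₁ = 0
          simp only [Derivation.add_apply, Derivation.smul_apply, Derivation.commutator_apply,
            vy1, hy1, hy2, hx1]
          simp only [map_zero, smul_eq_mul]; ring
        · change (_ : Der F) x₁ = 0
          simp only [Derivation.add_apply, Derivation.smul_apply, Derivation.commutator_apply,
            vy1, hy1, hy2, hx2]
          simp only [map_zero, smul_eq_mul]; ring
        · change (_ : Der F) y₂ = 0
          simp only [Derivation.add_apply, Derivation.smul_apply, Derivation.commutator_apply,
            vy2, hy3, hy4, hx3]
          simp only [Derivation.map_one_eq_zero, smul_eq_mul]; ring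
        · change (_ : Der F) x₂ = 0
          simp only [Derivation.add_apply, Derivation.smul_apply, Derivation.commutator_apply,
            vy2, hy3, hy4, hx4]
          simp only [map_zero, smul_eq_mul]; ring) b
    simp only [Derivation.add_apply, Derivation.smul_apply, Derivation.commutator_apply,
      smul_eq_mul] at h
    linear_combination h
  · have h := hs.der_eq_zero (D := ⁅δ, θx⁆ + (2 * y₂ ^ 2) • θy +
        (-(4 * x₂ * y₂ - 2 * y₂ + algebraMap K F a)) • θx)
      (fun r => by
        simp only [Derivation.add_apply, Derivation.smul_apply, Derivation.commutator_apply, hyK,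
          hxK, hd, map_zero]
        simp)
      (fun i => by
        fin_cases i
        · change (_ : Der F) y₁ = 0
          simp only [Derivation.add_apply, Derivation.smul_apply, Derivation.commutator_apply,
            vx1, hy1, hx1, hx2]
          simp only [map_zero, smul_eq_mul]; ring
        · change (_ : Der F) x₁ = 0
          simp only [Derivation.add_apply, Derivation.smul_apply, Derivation.commutator_apply,
            vx1, hy2, hx1, hx2]
          simp only [map_zero, smul_eq_mul]; ring
        · change (_ : Der F) y₂ = 0
          simp only [Derivation.add_apply, Derivation.smul_apply, Derivation.commutator_apply,
            vx2, hy3, hx3, hx4]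
          simp only [map_zero, smul_eq_mul]; ring
        · change (_ : Der F) x₂ = 0
          simp only [Derivation.add_apply, Derivation.smul_apply, Derivation.commutator_apply,
            vx2, hy4, hx3, hx4]
          simp only [Derivation.map_one_eq_zero, smul_eq_mul]; ring) b
    simp only [Derivation.add_apply, Derivation.smul_apply, Derivation.commutator_apply,
      smul_eq_mul] at h
    linear_combination h

theorem false_of_three_bases {δ : Der F} {d : Der K}
    (hd : ∀ r, δ (algebraMap K F r) = algebraMap K F (d r)) {t a c : K} (ht : t ≠ 0)
    (hdt : d t = t)
    (hlin : ∀ s q r : ℤ, (a - 1) * s = c * q + (a - c) * r → s = 0 ∧ q = 0 ∧ r = 0)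
    {y₁ x₁ y₂ x₂ y₃ x₃ : F}
    (h₁ : IsPVSolution δ (algebraMap K F t) (algebraMap K F a) (algebraMap K F c) y₁ x₁)
    (h₂ : IsPVSolution δ (algebraMap K F t) (algebraMap K F a) (algebraMap K F c) y₂ x₂)
    (h₃ : IsPVSolution δ (algebraMap K F t) (algebraMap K F a) (algebraMap K F c) y₃ x₃)
    (h₁₂ : IsTranscendenceBasis K ![y₁, x₁, y₂, x₂])
    (h₂₃ : IsTranscendenceBasis K ![y₂, x₂, y₃, x₃])
    (h₁₃ : IsTranscendenceBasis K ![y₁, x₁, y₃, x₃]) : False := by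
  obtain ⟨Ey, Ex, hEyK, hExK, ⟨hEy1, hEy2, hEx1, hEx2⟩, ⟨hEy3, hEy4, hEx3, hEx4⟩, -, hEyδ, hExδ⟩ :=
    exists_dual_derivations hd h₁ h₂ h₁₂
  obtain ⟨θy, θx, hyK, hxK, ⟨hy1, hy2, hx1, hx2⟩, ⟨hy3, hy4, hx3, hx4⟩, hcomm, hyδ, hxδ⟩ :=
    exists_dual_derivations hd h₂ h₃ h₂₃
  let k : IntermediateField K F := (θy.ker ⊓ θx.ker).toIntermediateField fun r => ⟨hyK r, hxK r⟩
  have hk : ∀ b, b ∈ k ↔ θy b = 0 ∧ θx b = 0 := fun b => Iff.rfl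
  have hkδ : ∀ b ∈ k, δ b ∈ k := by
    intro b hb
    obtain ⟨h0, h1⟩ := (hk b).1 hb
    have e1 := hyδ b
    have e2 := hxδ b
    rw [h0, h1, map_zero] at e1 e2
    refine (hk _).2 ⟨by linear_combination -e1, by linear_combination -e2⟩
  let δk : Der k := δ.restrict k hkδ
  have hδk : ∀ r, δ (algebraMap k F r) = algebraMap k F (δk r) := fun r => rfl
  let ι := algebraMap K k
  have hι : ∀ r, algebraMap k F (ι r) = algebraMap K F r := fun r => rfl
  have hιinj : Function.Injective ι := ι.injective
  have : CharZero k := charZero_of_injective_algebraMap hιinj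
  have htk : ι t ≠ 0 := by rwa [Ne, map_eq_zero]
  have hdtk : δk (ι t) = ι t := by
    apply (algebraMap k F).injective
    rw [← hδk, hι, hd, hdt]
  have hlink : ∀ s q r : ℤ, (ι a - 1) * s = ι c * q + (ι a - ι c) * r → s = 0 ∧ q = 0 ∧ r = 0 := by
    intro s q r h
    refine hlin s q r (hιinj ?_)
    simpa using h
  have hcompat := aevalAeval_pvDer δk δ hδk (ι t) (ι a) (ι c) x₃ y₃ h₃.1 h₃.2
  have hΔ := exists_CC_of_dvd_pvDer δk (ι t) (ι a) (ι c) htk hdtk hlink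
  set φ := aevalAeval (R := k) x₃ y₃ with hφ
  have hyk : y₂ ∈ k := (hk _).2 ⟨hy1, hx1⟩
  have hxk : x₂ ∈ k := (hk _).2 ⟨hy2, hx2⟩
  have hkA : ∀ b ∈ k, b ∈ φ.range := fun b hb => φ.range.algebraMap_mem ⟨b, hb⟩
  have hyA : y₃ ∈ φ.range := ⟨X, aevalAeval_outer x₃ y₃⟩
  have hxA : x₃ ∈ φ.range := ⟨C X, aevalAeval_inner x₃ y₃⟩
  have halg : Algebra.IsAlgebraic φ.range F := by
    refine ⟨fun b => (h₂₃.isAlgebraic.isAlgebraic b).mono_subset φ.range fun u hu => ?_⟩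
    induction hu using Algebra.adjoin_induction with
    | mem x hx =>
      obtain ⟨i, rfl⟩ := hx
      fin_cases i
      exacts [hkA _ hyk, hkA _ hxk, hyA, hxA]
    | algebraMap r => exact hkA _ (k.algebraMap_mem r)
    | add x y _ _ hx hy => exact add_mem hx hy
    | mul x y _ _ hx hy => exact mul_mem hx hy
  have hinj : ∀ p, φ p = 0 → p = 0 := by
    rw [← algebraicIndependent_pair_iff]
    refine (isAlgebraic_or_algebraicIndependent δk δ hδk (ι t) (ι a) (ι c) htk hdtk hlink x₃ y₃
      h₃.1 h₃.2).resolve_left fun h => ?_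
    exact one_ne_zero (hy3.symm.trans
      (derivation_eq_zero_of_isAlgebraic θy (fun r => ((hk _).1 r.2).1) h.2))
  let E : Fin 2 → Der F := ![Ey, Ex]
  let m : k := ⟨4 * x₂ * y₂ - 2 * y₂ + algebraMap K F a, by
    refine k.add_mem (k.sub_mem (k.mul_mem (k.mul_mem ?_ hxk) hyk) (k.mul_mem ?_ hyk))
      (k.algebraMap_mem a)
    · exact ofNat_mem k 4
    · exact ofNat_mem k 2⟩
  let w : k := ⟨2 * x₂ - 2 * x₂ ^ 2, k.sub_mem (k.mul_mem (ofNat_mem k 2) hxk)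
    (k.mul_mem (ofNat_mem k 2) (pow_mem hxk 2))⟩
  let u : k := ⟨2 * y₂ ^ 2, k.mul_mem (ofNat_mem k 2) (pow_mem hyk 2)⟩
  let M : Fin 2 → Fin 2 → k := ![![m, u], ![w, -m]]
  have hEK : ∀ j r, E j (algebraMap K F r) = 0 := by
    intro j r
    fin_cases j
    exacts [hEyK r, hExK r]
  have hEδ : ∀ j b, δ (E j b) = E j (δ b) - ∑ i, algebraMap k F (M i j) * E i b := by
    intro j b
    rw [Fin.sum_univ_two]
    fin_cases j
    exacts [hEyδ b, hExδ b]
  have hEv := fun j => h₃.variational (hEK j t) (hEK j a) (hEK j c)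
  have hJy : ∀ j, δ (E j y₃) = (4 * x₃ * y₃ - 2 * y₃ + algebraMap K F a) * E j y₃ +
      2 * y₃ ^ 2 * E j x₃ - ∑ i, algebraMap k F (M i j) * E i y₃ := fun j => by
    rw [hEδ, (hEv j).1]
  have hJx : ∀ j, δ (E j x₃) = (2 * x₃ - 2 * x₃ ^ 2) * E j y₃ -
      (4 * x₃ * y₃ - 2 * y₃ + algebraMap K F a) * E j x₃ -
      ∑ i, algebraMap k F (M i j) * E i x₃ := fun j => by
    rw [hEδ, (hEv j).2]
  obtain ⟨hα, hβ, hγ⟩ := aevalAeval_jacobian x₃ y₃ (ι a)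
  rw [← hφ, hι] at hα
  rw [← hφ] at hβ hγ
  classical
  let G : Finset F := Finset.univ.image (fun j => E j y₃) ∪ Finset.univ.image (fun j => E j x₃)
  have hGy : ∀ j, E j y₃ ∈ Submodule.span φ.range (G : Set F) := fun j =>
    Submodule.subset_span (by simp [G])
  have hGx : ∀ j, E j x₃ ∈ Submodule.span φ.range (G : Set F) := fun j =>
    Submodule.subset_span (by simp [G])
  have hsm : ∀ {a b : F}, a ∈ φ.range → b ∈ Submodule.span φ.range (G : Set F) →
      a * b ∈ Submodule.span φ.range (G : Set F) := fun ha hb =>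
    Submodule.smul_mem _ (⟨_, ha⟩ : φ.range) hb
  have hG : ∀ g ∈ G, δ g ∈ Submodule.span φ.range (G : Set F) := by
    intro g hg
    have hS : ∀ (z : F) (j : Fin 2), (∀ i, E i z ∈ Submodule.span φ.range (G : Set F)) →
        ∑ i, algebraMap k F (M i j) * E i z ∈ Submodule.span φ.range (G : Set F) := fun z j hz =>
      Submodule.sum_mem _ fun i _ => hsm (hkA _ (M i j).2) (hz i)
    simp only [G, Finset.mem_union, Finset.mem_image, Finset.mem_univ, true_and] at hg
    obtain ⟨j, rfl⟩ | ⟨j, rfl⟩ := hg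
    · rw [hJy, ← hα, ← hγ]
      exact sub_mem (add_mem (hsm ⟨_, rfl⟩ (hGy j)) (hsm ⟨_, rfl⟩ (hGx j))) (hS _ _ hGy)
    · rw [hJx, ← hα, ← hβ]
      exact sub_mem (sub_mem (hsm ⟨_, rfl⟩ (hGy j)) (hsm ⟨_, rfl⟩ (hGx j))) (hS _ _ hGx)
  have hmem : ∀ b, DerFinite φ.range δ b → b ∈ φ.range := fun b hb =>
    hb.mem_range_of_dual (pvDer δk (ι t) (ι a) (ι c)) hcompat hΔ halg
      (fun r => ((hk _).1 r.2).1) (fun r => ((hk _).1 r.2).2) hy3 hy4 hx3 hx4 hcomm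
      (fun b h0 h1 => ⟨⟨b, (hk b).2 ⟨h0, h1⟩⟩, rfl⟩)
      (α := 4 * X * C X - 2 * X + C (C (ι a))) (β := 2 * C X - 2 * C X ^ 2) (γ := 2 * X ^ 2)
      (ε := -(4 * X * C X - 2 * X + C (C (ι a))))
      (by intro b; rw [← hφ, hα, hβ]; exact hyδ b)
      (by intro b; rw [← hφ, map_neg, hα, hγ]; exact hxδ b)
  have hPex : ∀ j, ∃ p, φ p = E j y₃ := fun j => hmem _ ⟨G, hG, hGy j⟩
  have hQex : ∀ j, ∃ p, φ p = E j x₃ := fun j => hmem _ ⟨G, hG, hGx j⟩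
  choose P hP using hPex
  choose Q hQ using hQex
  have hCC : ∀ r, φ (C (C r)) = algebraMap k F r := fun r => aevalAeval_CC x₃ y₃ r
  have hsub : ∀ p q, φ (p - q) = φ p - φ q := map_sub φ
  have hneg : ∀ p, φ (-p) = -φ p := map_neg φ
  have heq : ∀ p q, φ p = φ q → p = q := fun p q h =>
    sub_eq_zero.1 (hinj _ (by rw [hsub, h, sub_self]))
  obtain ⟨e0, e1, he, hPe, hQe⟩ := jacobian_degenerate δk (ι t) (ι a) (ι c) htk hdtk hlink P Q M
    (by simp [M])
    (fun j => heq _ _ (by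
      rw [← hcompat, hP, hJy, outerDer_pvA, innerDer_pvA, hsub, map_add, map_mul, map_mul,
        map_sum, hα, hγ, hP, hQ]
      simp only [map_mul, hCC, hP]))
    (fun j => heq _ _ (by
      rw [← hcompat, hQ, hJx, outerDer_pvB, innerDer_pvB, hsub, map_add, map_mul, map_mul,
        map_sum, hneg, hα, hβ, hP, hQ]
      simp only [map_mul, hCC, hQ]
      ring))
  have hPe' := congrArg φ hPe
  have hQe' := congrArg φ hQe
  rw [map_mul, map_mul, hCC, hCC, hP, hP] at hPe'
  rw [map_mul, map_mul, hCC, hCC, hQ, hQ] at hQe'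
  have h0 := h₁₃.der_eq_zero (D := algebraMap k F e1 • Ey - algebraMap k F e0 • Ex)
    (fun r => by simp only [Derivation.sub_apply, Derivation.smul_apply, hEyK, hExK]; simp)
    (fun i => by
      fin_cases i
      · change (_ : Der F) y₁ = 0
        simp only [Derivation.sub_apply, Derivation.smul_apply, hEy1, hEx1]; simp
      · change (_ : Der F) x₁ = 0
        simp only [Derivation.sub_apply, Derivation.smul_apply, hEy2, hEx2]; simp
      · exact sub_eq_zero.2 hPe'
      · exact sub_eq_zero.2 hQe')
  have h0y := h0 y₂
  have h0x := h0 x₂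
  simp only [Derivation.sub_apply, Derivation.smul_apply, hEy3, hEy4, hEx3, hEx4, smul_eq_mul,
    mul_zero, mul_one, sub_zero, zero_sub, neg_eq_zero, map_eq_zero] at h0y h0x
  exact he.elim (fun h => h h0x) fun h => h h0y

end ThreeSolutions

section Independence

variable {K L : Type*} [Field K] [Field L] [Algebra K L]

theorem algebraicIndependent_sumElim_adjoin_iff {ι κ : Type*} {u : ι → L} {s : κ → L} :
    AlgebraicIndependent K (Sum.elim u s) ↔ AlgebraicIndependent K s ∧
      AlgebraicIndependent (IntermediateField.adjoin K (Set.range s)) u := by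
  rw [AlgebraicIndependent.sumElim_iff, IntermediateField.algebraicIndependent_adjoin_iff]

theorem IsPVSolution.mem {δ : Der L} {t a c : K} {y x : L}
    (h : IsPVSolution δ (algebraMap K L t) (algebraMap K L a) (algebraMap K L c) y x)
    (E : IntermediateField K L) (hy : y ∈ E) (hx : x ∈ E) : δ y ∈ E ∧ δ x ∈ E := by
  lift y to E using hy
  lift x to E using hx
  rw [h.1, h.2]
  exact ⟨(2 * y ^ 2 * x - y ^ 2 + algebraMap K E a * y + algebraMap K E t).2,
    (-(2 * y * x ^ 2) + 2 * y * x - algebraMap K E a * x + algebraMap K E c).2⟩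

theorem IsPVSolution.stable_adjoin {δ : Der L} {d : Der K}
    (hd : ∀ r, δ (algebraMap K L r) = algebraMap K L (d r)) {t a c : K} {y x : L}
    (h : IsPVSolution δ (algebraMap K L t) (algebraMap K L a) (algebraMap K L c) y x) :
    ∀ b ∈ IntermediateField.adjoin K (Set.range ![y, x]),
      δ b ∈ IntermediateField.adjoin K (Set.range ![y, x]) := by
  have hm : ∀ i, ![y, x] i ∈ IntermediateField.adjoin K (Set.range ![y, x]) := fun i =>
    IntermediateField.subset_adjoin _ _ ⟨i, rfl⟩
  have hδ := h.mem _ (hm 0) (hm 1)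
  refine fun b => derivation_mem_adjoin δ _ _ rfl
    (fun r => by rw [hd]; exact IntermediateField.algebraMap_mem _ _) ?_
  rintro _ ⟨i, rfl⟩
  fin_cases i
  exacts [hδ.1, hδ.2]

theorem IsPVSolution.stable_adjoin_pair {δ : Der L} {d : Der K}
    (hd : ∀ r, δ (algebraMap K L r) = algebraMap K L (d r)) {t a c : K} {y₁ x₁ y₂ x₂ : L}
    (h₁ : IsPVSolution δ (algebraMap K L t) (algebraMap K L a) (algebraMap K L c) y₁ x₁)
    (h₂ : IsPVSolution δ (algebraMap K L t) (algebraMap K L a) (algebraMap K L c) y₂ x₂) :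
    ∀ b ∈ IntermediateField.adjoin K (Set.range ![y₁, x₁, y₂, x₂]),
      δ b ∈ IntermediateField.adjoin K (Set.range ![y₁, x₁, y₂, x₂]) := by
  have hm : ∀ i, ![y₁, x₁, y₂, x₂] i ∈
      IntermediateField.adjoin K (Set.range ![y₁, x₁, y₂, x₂]) := fun i =>
    IntermediateField.subset_adjoin _ _ ⟨i, rfl⟩
  have hδ₁ := h₁.mem _ (hm 0) (hm 1)
  have hδ₂ := h₂.mem _ (hm 2) (hm 3)
  refine fun b => derivation_mem_adjoin δ _ _ rfl
    (fun r => by rw [hd]; exact IntermediateField.algebraMap_mem _ _) ?_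
  rintro _ ⟨i, rfl⟩
  fin_cases i
  exacts [hδ₁.1, hδ₁.2, hδ₂.1, hδ₂.2]

theorem intCast_relation_map {a c : K} (E : IntermediateField K L)
    (hlin : ∀ s q r : ℤ, (a - 1) * s = c * q + (a - c) * r → s = 0 ∧ q = 0 ∧ r = 0) :
    ∀ s q r : ℤ, (algebraMap K E a - 1) * s =
      algebraMap K E c * q + (algebraMap K E a - algebraMap K E c) * r →
        s = 0 ∧ q = 0 ∧ r = 0 := by
  intro s q r h
  refine hlin s q r ((algebraMap K E).injective ?_)
  simpa using h

theorem AlgebraicIndependent.isTranscendenceBasis_of_isAlgebraic {ι : Type*} {s : ι → L}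
    (hs : AlgebraicIndependent K s)
    (halg : ∀ b : L, IsAlgebraic (IntermediateField.adjoin K (Set.range s)) b) :
    IsTranscendenceBasis K s := by
  rw [hs.isTranscendenceBasis_iff_isAlgebraic, ← IntermediateField.isAlgebraic_adjoin_iff_top]
  exact ⟨halg⟩

theorem IsTranscendenceBasis.of_algebraicIndependent_four {s u : Fin 4 → L}
    (hs : IsTranscendenceBasis K s) (hu : AlgebraicIndependent K u) : IsTranscendenceBasis K u :=
  hu.isTranscendenceBasis_of_lift_trdeg_le_of_finite hs.lift_cardinalMk_eq_trdeg.ge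

theorem algebraicIndependent_pair_adjoin {y₁ x₁ y₂ x₂ : L}
    (h : AlgebraicIndependent K ![y₁, x₁, y₂, x₂]) :
    AlgebraicIndependent (IntermediateField.adjoin K (Set.range ![y₁, x₁])) ![y₂, x₂] := by
  refine (algebraicIndependent_sumElim_adjoin_iff.1 ?_).2
  have h7 := h.comp (Sum.elim ![2, 3] ![0, 1] : Fin 2 ⊕ Fin 2 → Fin 4) (by decide)
  convert h7 using 1
  ext i
  rcases i with i | i <;> fin_cases i <;> rfl

variable [CharZero K]

theorem algebraicIndependent_adjoin_of_pairs {δ : Der L} {d : Der K}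
    (hd : ∀ r, δ (algebraMap K L r) = algebraMap K L (d r)) {t a c : K} (ht : t ≠ 0)
    (hdt : d t = t)
    (hlin : ∀ s q r : ℤ, (a - 1) * s = c * q + (a - c) * r → s = 0 ∧ q = 0 ∧ r = 0)
    {y₁ x₁ y₂ x₂ y₃ x₃ : L}
    (h₁ : IsPVSolution δ (algebraMap K L t) (algebraMap K L a) (algebraMap K L c) y₁ x₁)
    (h₂ : IsPVSolution δ (algebraMap K L t) (algebraMap K L a) (algebraMap K L c) y₂ x₂)
    (h₃ : IsPVSolution δ (algebraMap K L t) (algebraMap K L a) (algebraMap K L c) y₃ x₃)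
    (h₁₂ : AlgebraicIndependent K ![y₁, x₁, y₂, x₂])
    (h₂₃ : AlgebraicIndependent K ![y₂, x₂, y₃, x₃])
    (h₁₃ : AlgebraicIndependent K ![y₁, x₁, y₃, x₃]) :
    AlgebraicIndependent (IntermediateField.adjoin K (Set.range ![y₁, x₁]))
      ![y₂, x₂, y₃, x₃] := by
  let E := IntermediateField.adjoin K (Set.range ![y₁, x₁, y₂, x₂])
  have hE : ∀ b ∈ E, δ b ∈ E := h₁.stable_adjoin_pair hd h₂
  have hδE : ∀ r, δ (algebraMap E L r) = algebraMap E L (δ.restrict E hE r) := fun r => rfl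
  have : CharZero E := charZero_of_injective_algebraMap (algebraMap K E).injective
  have htE : algebraMap K E t ≠ 0 := by rwa [Ne, map_eq_zero]
  have hdtE : δ.restrict E hE (algebraMap K E t) = algebraMap K E t := by
    apply (algebraMap E L).injective
    rw [← hδE]
    change δ (algebraMap K L t) = algebraMap K L t
    rw [hd, hdt]
  obtain ⟨hx, hy⟩ | h := isAlgebraic_or_algebraicIndependent (δ.restrict E hE) δ hδE
    (algebraMap K E t) (algebraMap K E a) (algebraMap K E c) htE hdtE
    (intCast_relation_map E hlin) x₃ y₃ h₃.1 h₃.2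
  · exfalso
    let F : IntermediateField K L := (algebraicClosure E L).restrictScalars K
    have hF : ∀ b, b ∈ F ↔ IsAlgebraic E b := fun b => mem_algebraicClosure_iff
    have hFδ : ∀ b ∈ F, δ b ∈ F := fun b hb =>
      derivation_mem_of_isAlgebraic δ (algebraicClosure E L)
        (fun r => by
          rw [hδE]
          exact (algebraicClosure E L).algebraMap_mem _) hb ((hF b).1 hb)
    have hEF : ∀ i, ![y₁, x₁, y₂, x₂] i ∈ F := fun i =>
      (hF _).2 (isAlgebraic_algebraMap
        (⟨_, IntermediateField.subset_adjoin _ _ ⟨i, rfl⟩⟩ : E))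
    have hFd : ∀ r, δ.restrict F hFδ (algebraMap K F r) = algebraMap K F (d r) := fun r =>
      Subtype.ext (hd r)
    let Y₁ : F := ⟨y₁, hEF 0⟩
    let X₁ : F := ⟨x₁, hEF 1⟩
    let Y₂ : F := ⟨y₂, hEF 2⟩
    let X₂ : F := ⟨x₂, hEF 3⟩
    let Y₃ : F := ⟨y₃, (hF _).2 hy⟩
    let X₃ : F := ⟨x₃, (hF _).2 hx⟩
    have hind : ∀ p q r s : F, AlgebraicIndependent K ![(p : L), q, r, s] →
        AlgebraicIndependent K ![p, q, r, s] := by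
      intro p q r s h
      refine (F.val.algebraicIndependent_iff F.val.injective).1 ?_
      convert h using 1
      ext i
      fin_cases i <;> rfl
    have hb₁₂ : IsTranscendenceBasis K ![Y₁, X₁, Y₂, X₂] := by
      refine (hind Y₁ X₁ Y₂ X₂ h₁₂).isTranscendenceBasis_of_isAlgebraic fun b => ?_
      rw [IntermediateField.isAlgebraic_adjoin_iff]
      have hb := (hF b).1 b.2
      rw [IntermediateField.isAlgebraic_adjoin_iff] at hb
      have hr : (Algebra.adjoin K (Set.range ![Y₁, X₁, Y₂, X₂])).map F.val =
          Algebra.adjoin K (Set.range ![y₁, x₁, y₂, x₂]) := by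
        rw [AlgHom.map_adjoin, ← Set.range_comp]
        congr 2
        ext i
        fin_cases i <;> rfl
      rw [← hr] at hb
      let f := (F.val.toRingHom.comp
        (Algebra.adjoin K (Set.range ![Y₁, X₁, Y₂, X₂])).val.toRingHom).codRestrict
          ((Algebra.adjoin K (Set.range ![Y₁, X₁, Y₂, X₂])).map F.val) fun r => ⟨r, r.2, rfl⟩
      refine IsAlgebraic.of_ringHom_of_comp_eq f F.val.toRingHom hb ?_ F.val.injective rfl
      rintro ⟨_, r, hr, rfl⟩
      exact ⟨⟨r, hr⟩, rfl⟩
    refine false_of_three_bases hFd ht hdt hlin (y₁ := Y₁) (x₁ := X₁) (y₂ := Y₂) (x₂ := X₂)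
      (y₃ := Y₃) (x₃ := X₃) ⟨Subtype.ext h₁.1, Subtype.ext h₁.2⟩
      ⟨Subtype.ext h₂.1, Subtype.ext h₂.2⟩
      ⟨Subtype.ext h₃.1, Subtype.ext h₃.2⟩ hb₁₂
      (hb₁₂.of_algebraicIndependent_four (hind _ _ _ _ h₂₃))
      (hb₁₂.of_algebraicIndependent_four (hind _ _ _ _ h₁₃))
  · have h6 : AlgebraicIndependent K (Sum.elim ![x₃, y₃] ![y₁, x₁, y₂, x₂]) :=
      algebraicIndependent_sumElim_adjoin_iff.2 ⟨h₁₂, h⟩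
    have h7 := h6.comp (Sum.elim ![.inr 2, .inr 3, .inl 1, .inl 0] ![.inr 0, .inr 1] :
      Fin 4 ⊕ Fin 2 → Fin 2 ⊕ Fin 4) (by decide)
    refine (algebraicIndependent_sumElim_adjoin_iff.1 ?_).2
    convert h7 using 1
    ext i
    rcases i with i | i <;> fin_cases i <;> rfl

end Independence

theorem algebraicIndependent_sumElim_of_pairs.{u} {L : Type u} [Field L] {δ : Der L} (n : ℕ) :
    ∀ {K : Type u} [Field K] [CharZero K] [Algebra K L] {d : Der K}
      (_ : ∀ r, δ (algebraMap K L r) = algebraMap K L (d r)) {t a c : K} (_ : t ≠ 0) (_ : d t = t)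
      (_ : ∀ s q r : ℤ, (a - 1) * s = c * q + (a - c) * r → s = 0 ∧ q = 0 ∧ r = 0)
      (y x : Fin n → L) (_ : ∀ i, IsPVSolution δ (algebraMap K L t) (algebraMap K L a)
        (algebraMap K L c) (y i) (x i)) (_ : ∀ i, AlgebraicIndependent K ![y i, x i])
      (_ : ∀ i j, i < j → AlgebraicIndependent K ![y i, x i, y j, x j]),
      AlgebraicIndependent K (Sum.elim y x) := by
  induction n with
  | zero =>
    intro K _ _ _ d _ t a c _ _ _ y x _ _ _
    exact algebraicIndependent_empty_type_iff.2 (algebraMap K L).injective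
  | succ n ih =>
    intro K _ _ _ d hd t a c ht hdt hlin y x hsol h1 h2
    let E := IntermediateField.adjoin K (Set.range ![y 0, x 0])
    have hE : ∀ b ∈ E, δ b ∈ E := (hsol 0).stable_adjoin hd
    have : CharZero E := charZero_of_injective_algebraMap (algebraMap K E).injective
    have hE1 : AlgebraicIndependent E (Sum.elim (y ∘ Fin.succ) (x ∘ Fin.succ)) :=
      ih (d := δ.restrict E hE) (fun r => rfl) (t := algebraMap K E t) (a := algebraMap K E a)
        (c := algebraMap K E c) (by rwa [Ne, map_eq_zero])
        (Subtype.ext ((hd t).trans (congrArg _ hdt))) (intCast_relation_map E hlin) _ _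
        (fun i => hsol i.succ) (fun i => algebraicIndependent_pair_adjoin (h2 _ _ i.succ_pos))
        (fun i j hij => algebraicIndependent_adjoin_of_pairs hd ht hdt hlin (hsol 0) (hsol _)
          (hsol _) (h2 _ _ i.succ_pos) (h2 _ _ (Fin.succ_lt_succ_iff.2 hij))
          (h2 _ _ j.succ_pos))
    have h3 := algebraicIndependent_sumElim_adjoin_iff.2 ⟨h1 0, hE1⟩
    have h4 := h3.comp (Sum.elim (Fin.cases (.inr 0) fun i => .inl (.inl i))
      (Fin.cases (.inr 1) fun i => .inl (.inr i)) :
        Fin (n + 1) ⊕ Fin (n + 1) → (Fin n ⊕ Fin n) ⊕ Fin 2) (by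
      rintro (i | i) (j | j) <;> induction i using Fin.cases <;> induction j using Fin.cases <;>
        simp)
    convert h4 using 1
    ext i
    rcases i with i | i <;> induction i using Fin.cases <;> rfl

theorem eq_zero_of_intCast_linear_relation {v₁ v₂ : ℂ} (hv : AlgebraicIndependent ℚ ![v₁, v₂])
    {p q r : ℤ} (h : v₁ * p + v₂ * q + r = 0) : p = 0 ∧ q = 0 ∧ r = 0 := by
  let P : MvPolynomial (Fin 2) ℚ := .X 0 * .C (p : ℚ) + .X 1 * .C (q : ℚ) + .C (r : ℚ)
  have hP : P = 0 := by
    refine (injective_iff_map_eq_zero _).1 hv P ?_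
    simpa [P] using h
  have he : ∀ u : Fin 2 → ℚ, u 0 * p + u 1 * q + r = 0 := fun u => by
    simpa [P] using congrArg (MvPolynomial.eval u) hP
  have h0 : (r : ℚ) = 0 := by simpa using he 0
  have h1 : (p : ℚ) = 0 := by simpa [h0] using he ![1, 0]
  have h2 : (q : ℚ) = 0 := by simpa [h0] using he ![0, 1]
  exact ⟨by exact_mod_cast h1, by exact_mod_cast h2, by exact_mod_cast h0⟩

/-- Geometric triviality of the generic Hamiltonian system `S_III'(v₁,v₂)` (Proposition 3.9):
for `v₁, v₂ ∈ ℂ` algebraically independent over `ℚ`, if solutions `(y₁,x₁), …, (yₙ,xₙ)` are such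
that `y₁, x₁, …, yₙ, xₙ` are algebraically dependent over a differential subfield `K`, then
already some pair `yᵢ, xᵢ, yⱼ, xⱼ` (`i < j`) is algebraically dependent over `K`. -/
theorem painleveIII_system_geometrically_trivial
    (v₁ v₂ : ℂ) (hv : AlgebraicIndependent ℚ ![v₁, v₂])
    (L : Type*) [Field L] [Algebra ℂ L]
    (D : L → L)
    (hD_add : ∀ a b : L, D (a + b) = D a + D b)
    (hD_mul : ∀ a b : L, D (a * b) = a * D b + b * D a)
    (hD_const : ∀ c : ℂ, D (algebraMap ℂ L c) = 0)
    (t : L) (hDt : D t = 1)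
    (K : Subfield L)
    (hK_const : ∀ c : ℂ, algebraMap ℂ L c ∈ K)
    (hK_t : t ∈ K)
    (hK_D : ∀ a ∈ K, D a ∈ K)
    (n : ℕ) (hn : 2 ≤ n)
    (y x : Fin n → L)
    (hsol₁ : ∀ i : Fin n,
      t * D (y i) = 2 * (y i) ^ 2 * x i - (y i) ^ 2 + algebraMap ℂ L v₁ * y i + t)
    (hsol₂ : ∀ i : Fin n,
      t * D (x i) = -(2 * y i * (x i) ^ 2) + 2 * y i * x i - algebraMap ℂ L v₁ * x i
          + algebraMap ℂ L ((v₁ + v₂) / 2))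
    (hdep : ¬ AlgebraicIndependent K (Sum.elim y x)) :
    ∃ i j : Fin n, i < j ∧ ¬ AlgebraicIndependent K ![y i, x i, y j, x j] := by
  by_contra! h
  have hD0 : D 0 = 0 := by simpa using hD_const 0
  have : CharZero L := charZero_of_injective_algebraMap (algebraMap ℂ L).injective
  let δ : Der L := Derivation.mk' (AddMonoidHom.toIntLinearMap
    { toFun := fun b => t * D b
      map_zero' := by rw [hD0, mul_zero]
      map_add' := fun a b => by rw [hD_add, mul_add] }) (fun a b => by
        change t * D (a * b) = a * (t * D b) + b * (t * D a)
        rw [hD_mul]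
        ring)
  have hδ : ∀ b, δ b = t * D b := fun b => rfl
  let d : Der K := Derivation.mk' (AddMonoidHom.toIntLinearMap
    { toFun := fun b => ⟨t * D b, K.mul_mem hK_t (hK_D _ b.2)⟩
      map_zero' := Subtype.ext (map_zero δ)
      map_add' := fun a b => Subtype.ext (map_add δ (a : L) b) }) (fun a b =>
        Subtype.ext (δ.leibniz (a : L) b))
  let a : K := ⟨algebraMap ℂ L v₁, hK_const _⟩
  let c : K := ⟨algebraMap ℂ L ((v₁ + v₂) / 2), hK_const _⟩
  have ht : t ≠ 0 := by
    rintro rfl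
    exact zero_ne_one (hD0.symm.trans hDt)
  refine hdep (algebraicIndependent_sumElim_of_pairs (δ := δ) n (d := d) (fun _ => rfl)
    (t := ⟨t, hK_t⟩) (a := a) (c := c) (fun h0 => ht (congrArg Subtype.val h0))
    (Subtype.ext ?_) ?_ y x (fun i => ⟨hsol₁ i, hsol₂ i⟩) (fun i => ?_) h)
  · change t * D t = t
    rw [hDt, mul_one]
  · intro s q r hs
    have hs' : algebraMap ℂ L ((v₁ - 1) * s) =
        algebraMap ℂ L ((v₁ + v₂) / 2 * q + (v₁ - (v₁ + v₂) / 2) * r) := by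
      simpa [a, c] using congrArg Subtype.val hs
    have hC := (algebraMap ℂ L).injective hs'
    obtain ⟨h1, h2, h3⟩ := eq_zero_of_intCast_linear_relation hv
      (p := 2 * s - q - r) (q := r - q) (r := -2 * s) (by
        push_cast
        linear_combination 2 * hC)
    omega
  · have hn' : Nontrivial (Fin n) := Fin.nontrivial_iff_two_le.2 hn
    obtain ⟨j, hj⟩ := exists_ne i
    obtain hij | hij := hj.lt_or_gt
    · convert (h j i hij).comp ![2, 3] (by decide) using 1
      ext k
      fin_cases k <;> rfl
    · convert (h i j hij).comp ![0, 1] (by decide) using 1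
      ext k
      fin_cases k <;> rfl
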